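/- arXiv:1507.05338 — 4 statements merged into one kernel-verified Lean document; each statement's English description precedes it below -/
import Mathlib

section
/- If G is a 2-connected graph on n vertices with minimum degree at least δ, then G contains a cycle of length at least min(n, 2δ). -/
/-- A graph is 2-connected if it has at least 3 vertices, is connected, and
remains connected after deleting any single vertex. -/
def TwoConnected {V : Type*} [Fintype V] (G : SimpleGraph V) : Prop :=
  3 ≤ Fintype.card V ∧ G.Connected ∧ ∀ v : V, (G.induce {w | w ≠ v}).Connected

namespace SimpleGraph

variable {V : Type*} {G : SimpleGraph V}

/-- The vertices `x 0, …, x m` are distinct and consecutive ones are adjacent. -/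
def IsPathSeq (G : SimpleGraph V) (x : ℕ → V) (m : ℕ) : Prop :=
  Set.InjOn x (Set.Iic m) ∧ ∀ i < m, G.Adj (x i) (x (i + 1))

namespace IsPathSeq

variable {x : ℕ → V} {m : ℕ}

lemma inj (hx : G.IsPathSeq x m) {i j : ℕ} (hi : i ≤ m) (hj : j ≤ m) (h : x i = x j) : i = j :=
  hx.1 hi hj h

lemma reverse (hx : G.IsPathSeq x m) : G.IsPathSeq (fun i => x (m - i)) m := by
  refine ⟨fun i hi j hj h => ?_, fun i hi => ?_⟩
  · simp only [Set.mem_Iic] at hi hj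
    have := hx.inj (by omega) (by omega) h
    omega
  · have := hx.2 (m - (i + 1)) (by omega)
    rw [show m - (i + 1) + 1 = m - i by omega] at this
    exact this.symm

end IsPathSeq

variable [DecidableEq V]

/-- Some path of `G` from `u` to `v` has vertex set exactly `U`. -/
def HasPathOn (G : SimpleGraph V) (u v : V) (U : Finset V) : Prop :=
  ∃ p : G.Walk u v, p.IsPath ∧ p.support.toFinset = U

namespace HasPathOn

variable {u v w z : V} {U W : Finset V}

lemma singleton (u : V) : G.HasPathOn u u {u} :=
  ⟨.nil, by simp, by simp⟩

lemma symm (h : G.HasPathOn u v U) : G.HasPathOn v u U := by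
  obtain ⟨p, hp, rfl⟩ := h
  exact ⟨p.reverse, hp.reverse, by simp⟩

lemma start_mem (h : G.HasPathOn u v U) : u ∈ U := by
  obtain ⟨p, hp, rfl⟩ := h
  simp

lemma end_mem (h : G.HasPathOn u v U) : v ∈ U := h.symm.start_mem

lemma cons (h : G.HasPathOn u v U) (hw : G.Adj w u) (hwU : w ∉ U) :
    G.HasPathOn w v (insert w U) := by
  obtain ⟨p, hp, rfl⟩ := h
  exact ⟨.cons hw p, by simp_all, by simp⟩

lemma append (h : G.HasPathOn u v U) (h' : G.HasPathOn v w W)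
    (hUW : ∀ y ∈ U, y ∈ W → y = v) : G.HasPathOn u w (U ∪ W) := by
  obtain ⟨p, hp, rfl⟩ := h
  induction p with
  | nil => simpa [h'.start_mem] using h'
  | cons huv p ih =>
    simp only [Walk.cons_isPath_iff] at hp
    simp only [Walk.support_cons, List.toFinset_cons, Finset.mem_insert] at hUW ⊢
    rw [Finset.insert_union]
    refine (ih h' hp.1 fun y hy => hUW y (.inr hy)).cons huv fun hmem => ?_
    rcases Finset.mem_union.1 hmem with hmem | hmem
    · exact hp.2 (List.mem_toFinset.1 hmem)
    · exact hp.2 (hUW _ (.inl rfl) hmem ▸ p.end_mem_support)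

lemma append_adj (h : G.HasPathOn u v U) (hvw : G.Adj v w) (h' : G.HasPathOn w z W)
    (hUW : Disjoint U W) : G.HasPathOn u z (U ∪ W) := by
  have hvW : v ∉ W := Finset.disjoint_left.1 hUW h.end_mem
  have := h.append (h'.cons hvw hvW) (by
    intro y hy hy'
    have := Finset.disjoint_left.1 hUW hy
    grind)
  rwa [Finset.union_insert, Finset.insert_eq_self.2 (Finset.mem_union_left _ h.end_mem)] at this

lemma exists_isCycle (h : G.HasPathOn u v U) (hvu : G.Adj v u) (hU : 3 ≤ U.card) :
    ∃ (a : V) (c : G.Walk a a), c.IsCycle ∧ c.length = U.card := by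
  obtain ⟨p, hp, rfl⟩ := h
  have hcard : p.support.toFinset.card = p.length + 1 := by
    rw [List.toFinset_card_of_nodup hp.support_nodup, Walk.length_support]
  refine ⟨v, .cons hvu p, ?_, by simp [hcard]⟩
  exact Walk.isCycle_iff_isPath_tail_and_le_length.2 ⟨by simpa using hp, by simp; omega⟩

lemma exists_isCycle_of_disjoint (h : G.HasPathOn u v U) (h' : G.HasPathOn u v W)
    (huv : u ≠ v) (hUW : ∀ y ∈ U, y ∈ W → y = u ∨ y = v) (hU : 3 ≤ U.card) :
    ∃ (a : V) (c : G.Walk a a), c.IsCycle ∧ U.card ≤ c.length := by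
  obtain ⟨q, hq, rfl⟩ := h'
  cases q with
  | nil => exact absurd rfl huv
  | @cons _ w _ huw q =>
    simp only [Walk.cons_isPath_iff] at hq
    have hqq : G.HasPathOn w v q.support.toFinset := ⟨q, hq.1, rfl⟩
    have hp := h.append hqq.symm (by
      intro y hy hy'
      simp only [List.mem_toFinset] at hy'
      rcases hUW y hy (by simp [hy']) with rfl | rfl
      · exact absurd hy' hq.2
      · rfl)
    have hle := Finset.card_le_card (Finset.subset_union_left (s₁ := U) (s₂ := q.support.toFinset))
    obtain ⟨a, c, hc, hlen⟩ := hp.exists_isCycle huw.symm (hU.trans hle)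
    exact ⟨a, c, hc, hlen ▸ hle⟩

lemma exists_isPathSeq (h : G.HasPathOn u v U) : ∃ (x : ℕ → V) (m : ℕ), G.IsPathSeq x m ∧
    x 0 = u ∧ x m = v ∧ (Finset.Iic m).image x = U := by
  obtain ⟨p, hp, rfl⟩ := h
  refine ⟨p.getVert, p.length, ⟨hp.getVert_injOn, fun i hi => p.adj_getVert_succ hi⟩,
    p.getVert_zero, p.getVert_length, ?_⟩
  ext y
  simp [Walk.mem_support_iff_exists_getVert, and_comm]

end HasPathOn

namespace IsPathSeq

variable {x : ℕ → V} {m : ℕ}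

lemma hasPathOn (hx : G.IsPathSeq x m) {i j : ℕ} (hij : i ≤ j) (hj : j ≤ m) :
    G.HasPathOn (x i) (x j) ((Finset.Icc i j).image x) := by
  induction j, hij using Nat.le_induction with
  | base => simpa using HasPathOn.singleton (x i)
  | succ j hij ih =>
    have := (ih (by omega)).symm.cons (hx.2 j (by omega)).symm (by
      simp only [Finset.mem_image, Finset.mem_Icc, not_exists, not_and]
      intro k hk h
      have := hx.inj (by omega) (by omega) h
      omega)
    rw [← Finset.image_insert] at this
    convert this.symm using 2
    ext k
    simp
    omega

lemma card_image (hx : G.IsPathSeq x m) {s : Finset ℕ} (hs : ∀ i ∈ s, i ≤ m) :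
    (s.image x).card = s.card :=
  Finset.card_image_of_injOn fun _ hi _ hj h => hx.inj (hs _ hi) (hs _ hj) h

end IsPathSeq

namespace HasPathOn

variable {u v w z : V} {U W : Finset V}

lemma exists_suffix (h : G.HasPathOn u v U) (hw : w ∈ U) :
    ∃ W ⊆ U, G.HasPathOn w v W ∧ (w ≠ u → u ∉ W) := by
  obtain ⟨x, m, hx, rfl, rfl, rfl⟩ := h.exists_isPathSeq
  simp only [Finset.mem_image, Finset.mem_Iic] at hw
  obtain ⟨k, hk, rfl⟩ := hw
  refine ⟨_, ?_, hx.hasPathOn hk le_rfl, ?_⟩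
  · exact Finset.image_subset_image fun i => by simp
  · simp only [Finset.mem_image, Finset.mem_Icc, not_exists, not_and]
    intro hne i hi h0
    have := hx.inj hi.2 (Nat.zero_le _) h0
    exact hne (by rw [show k = 0 by omega])

lemma exists_rotate (h : G.HasPathOn u v U) (hvu : G.Adj v u) (hw : w ∈ U) :
    ∃ z, G.HasPathOn w z U := by
  obtain ⟨x, m, hx, rfl, rfl, rfl⟩ := h.exists_isPathSeq
  simp only [Finset.mem_image, Finset.mem_Iic] at hw
  obtain ⟨k, hk, rfl⟩ := hw
  obtain _ | k := k
  · exact ⟨_, h⟩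
  · refine ⟨x k, ?_⟩
    have := (hx.hasPathOn hk le_rfl).append_adj hvu (hx.hasPathOn (Nat.zero_le k) (by omega)) (by
      simp only [Finset.disjoint_left, Finset.mem_image, Finset.mem_Icc, not_exists, not_and]
      rintro _ ⟨i, hi, rfl⟩ j hj hij
      have := hx.inj (by omega) (by omega) hij
      omega)
    rw [← Finset.image_union] at this
    convert this using 2
    ext i
    simp
    omega

end HasPathOn

/-- In a graph that stays connected after deleting `v`, two sets not contained in `{v}` are joined
by a path avoiding `v` that meets each of them only in its end. -/
lemma exists_hasPathOn_avoiding {v : V} (hv : (G.induce {w | w ≠ v}).Connected)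
    {U T : Finset V} (hU : ∃ z ∈ U, z ≠ v) (hT : ∃ y ∈ T, y ≠ v) :
    ∃ z ∈ U, ∃ y ∈ T, ∃ W, G.HasPathOn z y W ∧ v ∉ W ∧
      (∀ a ∈ W, a ∈ U → a = z) ∧ ∀ a ∈ W, a ∈ T → a = y := by
  classical
  have hex : ∃ n, ∃ z ∈ U, ∃ y ∈ T, ∃ W : Finset V, G.HasPathOn z y W ∧ v ∉ W ∧ W.card = n := by
    obtain ⟨z, hz, hzv⟩ := hU
    obtain ⟨y, hy, hyv⟩ := hT
    obtain ⟨p, hp⟩ := hv.exists_isPath ⟨z, hzv⟩ ⟨y, hyv⟩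
    let f := Embedding.induce (G := G) {w | w ≠ v}
    have hvp : v ∉ (p.map f.toHom).support := by
      simp only [Walk.support_map, List.mem_map, not_exists, not_and]
      exact fun a _ ha => a.2 ha
    exact ⟨_, z, hz, y, hy, _, ⟨p.map f.toHom, hp.map f.injective, rfl⟩,
      fun h => hvp (List.mem_toFinset.1 h), rfl⟩
  obtain ⟨z, hz, y, hy, W, hW, hvW, hcard⟩ := Nat.find_spec hex
  have hmin : ∀ z' ∈ U, ∀ y' ∈ T, ∀ W' : Finset V, W' ⊆ W → G.HasPathOn z' y' W' → W' = W := by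
    intro z' hz' y' hy' W' hsub hW'
    refine Finset.eq_of_subset_of_card_le hsub ?_
    rw [hcard]
    exact Nat.find_min' hex ⟨z', hz', y', hy', W', hW', fun h => hvW (hsub h), rfl⟩
  refine ⟨z, hz, y, hy, W, hW, hvW, fun a ha haU => ?_, fun a ha haT => ?_⟩
  · by_contra hne
    obtain ⟨W', hsub, hW', hnot⟩ := hW.exists_suffix ha
    exact hnot hne (hmin a haU y hy W' hsub hW' ▸ hW.start_mem)
  · by_contra hne
    obtain ⟨W', hsub, hW', hnot⟩ := hW.symm.exists_suffix ha
    exact hnot hne (hmin z hz a haT W' hsub hW'.symm ▸ hW.end_mem)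

/-- `U` contains `x t` but no later vertex of the sequence, and from every other vertex of `U` there
is a path to `x t` inside `U` that covers `S`. -/
structure IsCoveringSet (G : SimpleGraph V) (x : ℕ → V) (m : ℕ) (S : Finset V) (t : ℕ)
    (U : Finset V) : Prop where
  mem : x t ∈ U
  notMem : ∀ k, t < k → k ≤ m → x k ∉ U
  nontrivial : ∃ z ∈ U, z ≠ x t
  cover : ∀ z ∈ U, z ≠ x t → ∃ F ⊆ U, S ⊆ F ∧ G.HasPathOn z (x t) F

namespace IsCoveringSet

variable {x : ℕ → V} {m : ℕ} {S U W : Finset V} {t : ℕ}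

lemma eq_of_mem_image_Icc (hU : G.IsCoveringSet x m S t U) {s : ℕ} (hs : s ≤ m)
    {y : V} (hy : y ∈ U) (hy' : y ∈ (Finset.Icc t s).image x) : y = x t := by
  simp only [Finset.mem_image, Finset.mem_Icc] at hy'
  obtain ⟨k, hk, rfl⟩ := hy'
  by_contra hne
  have : k ≠ t := by rintro rfl; exact hne rfl
  exact hU.notMem k (by omega) (by omega) hy

/-- A covering set extends along a path that leaves it and meets the rest of the sequence in
`x s`. -/
lemma extend (hx : G.IsPathSeq x m) (hU : G.IsCoveringSet x m S t U) {s : ℕ} (hts : t < s)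
    (hs : s ≤ m) {z : V} (hz : z ∈ U) (hW : G.HasPathOn z (x s) W) (htW : x t ∉ W)
    (hWU : ∀ a ∈ W, a ∈ U → a = z) (hWx : ∀ k, t < k → k ≤ m → x k ∈ W → k = s) :
    G.IsCoveringSet x m S s (U ∪ W ∪ (Finset.Icc t s).image x) := by
  have hzt : z ≠ x t := by rintro rfl; exact htW hW.start_mem
  obtain ⟨F, hFU, hSF, hF⟩ := hU.cover z hz hzt
  have hseg := hx.hasPathOn hts.le hs
  have hsU : x s ∉ U := hU.notMem s hts hs
  have via : ∀ y ∈ U, y ≠ x t → ∃ F ⊆ U ∪ W ∪ (Finset.Icc t s).image x,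
      S ⊆ F ∧ G.HasPathOn y (x s) F := by
    intro y hy hyt
    obtain ⟨F, hFU, hSF, hF⟩ := hU.cover y hy hyt
    refine ⟨_, ?_, ?_, hF.append hseg fun a ha ha' => hU.eq_of_mem_image_Icc hs (hFU ha) ha'⟩
    · grind
    · grind
  refine ⟨by simp [hW.end_mem], ?_, ⟨z, by simp [hz], fun h => hsU (h ▸ hz)⟩, ?_⟩
  · intro k hk hkm hmem
    simp only [Finset.mem_union, Finset.mem_image, Finset.mem_Icc] at hmem
    rcases hmem with (hmem | hmem) | ⟨j, hj, hjk⟩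
    · exact hU.notMem k (by omega) hkm hmem
    · have := hWx k (by omega) hkm hmem
      omega
    · have := hx.inj (by omega) hkm hjk
      omega
  · intro y hy hys
    by_cases hyU : y ∈ U ∧ y ≠ x t
    · exact via y hyU.1 hyU.2
    by_cases hyW : y ∈ W
    · obtain ⟨W', hW'W, hW', hnot⟩ := hW.symm.exists_suffix hyW
      have h1 := hW'.append hF fun a ha ha' => hWU a (hW'W ha) (hFU ha')
      refine ⟨_, ?_, ?_, h1.append hseg fun a ha ha' => ?_⟩
      · grind
      · grind
      · rcases Finset.mem_union.1 ha with ha | ha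
        · simp only [Finset.mem_image, Finset.mem_Icc] at ha'
          obtain ⟨k, hk, rfl⟩ := ha'
          by_contra hne
          have hkt : k ≠ t := by rintro rfl; exact hne rfl
          have := hWx k (by omega) (by omega) (hW'W ha)
          subst this
          exact hnot hys ha
        · exact hU.eq_of_mem_image_Icc hs (hFU ha) ha'
    · have hyx : y ∈ (Finset.Icc t s).image x := by
        by_cases hyU' : y ∈ U
        · have : y = x t := by_contra fun h => hyU ⟨hyU', h⟩
          subst this
          exact hseg.start_mem
        · grind
      obtain ⟨j, hj, rfl⟩ := Finset.mem_image.1 hyx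
      rw [Finset.mem_Icc] at hj
      have hjs : j ≠ s := by rintro rfl; exact hys rfl
      have hsub : (Finset.Icc t j).image x ⊆ (Finset.Icc t s).image x :=
        Finset.image_subset_image (Finset.Icc_subset_Icc le_rfl hj.2)
      have h1 := (hx.hasPathOn hj.1 (hj.2.trans hs)).symm.append hF.symm fun a ha ha' =>
        hU.eq_of_mem_image_Icc (hj.2.trans hs) (hFU ha') ha
      refine ⟨_, ?_, ?_, h1.append hW fun a ha ha' => ?_⟩
      · grind
      · grind
      · rcases Finset.mem_union.1 ha with ha | ha
        · simp only [Finset.mem_image, Finset.mem_Icc] at ha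
          obtain ⟨k, hk, rfl⟩ := ha
          have hkt : k ≠ t := by rintro rfl; exact htW ha'
          have := hWx k (by omega) (by omega) ha'
          omega
        · exact hWU a ha' (hFU ha)

/-- Covering sets can be advanced along the sequence until a path leaving the set jumps beyond a
given index `b`. -/
lemma exists_jump (hG : ∀ v : V, (G.induce {w | w ≠ v}).Connected) (hx : G.IsPathSeq x m) {b : ℕ}
    (hb : b < m) (htb : t ≤ b) (hU : G.IsCoveringSet x m S t U) :
    ∃ t U s z W, t ≤ b ∧ b < s ∧ s ≤ m ∧ G.IsCoveringSet x m S t U ∧ z ∈ U ∧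
      G.HasPathOn z (x s) W ∧ x t ∉ W ∧ (∀ a ∈ W, a ∈ U → a = z) ∧
      ∀ k, t < k → k ≤ m → x k ∈ W → k = s := by
  induction hn : b - t using Nat.strong_induction_on generalizing t U with
  | _ n ih =>
    obtain ⟨z, hz, y, hy, W, hW, htW, hWU, hWT⟩ := exists_hasPathOn_avoiding (hG (x t))
      (T := (Finset.Ioc t m).image x) hU.nontrivial
      ⟨x m, Finset.mem_image_of_mem _ (by simp; omega), fun h => by
        have := hx.inj le_rfl (by omega) h
        omega⟩
    simp only [Finset.mem_image, Finset.mem_Ioc] at hy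
    obtain ⟨s, ⟨hts, hsm⟩, rfl⟩ := hy
    have hWx : ∀ k, t < k → k ≤ m → x k ∈ W → k = s := fun k hk hkm hmem =>
      hx.inj hkm hsm (hWT _ hmem (Finset.mem_image_of_mem _ (by simp; omega)))
    rcases le_or_gt s b with hsb | hsb
    · exact ih (b - s) (by omega) hsb (hU.extend hx hts hsm hz hW htW hWU hWx) rfl
    · exact ⟨t, U, s, z, W, htb, hsb, hsm, hU, hz, hW, htW, hWU, hWx⟩

end IsCoveringSet

/-- If `x 0` is adjacent to `x a`, then any earlier vertex is joined to `x a` by a path inside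
`x 0, …, x a` covering `x 0` and its neighbours. -/
lemma IsPathSeq.exists_cover {x : ℕ → V} {m : ℕ} (hx : G.IsPathSeq x m) {a q : ℕ} (ha : a ≤ m)
    (hadj : G.Adj (x 0) (x a)) (hq : q < a) :
    ∃ F ⊆ (Finset.Icc 0 a).image x, G.HasPathOn (x q) (x a) F ∧
      ∀ k ≤ a, k = 0 ∨ G.Adj (x 0) (x k) → x k ∈ F := by
  classical
  have hex : ∃ k, q < k ∧ G.Adj (x 0) (x k) := ⟨a, hq, hadj⟩
  obtain ⟨hqr, hr⟩ := Nat.find_spec hex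
  have hra : Nat.find hex ≤ a := Nat.find_min' hex ⟨hq, hadj⟩
  have hmin : ∀ k, q < k → G.Adj (x 0) (x k) → Nat.find hex ≤ k :=
    fun k h h' => Nat.find_min' hex ⟨h, h'⟩
  generalize Nat.find hex = r at *
  refine ⟨_, ?_, (hx.hasPathOn (Nat.zero_le q) (by omega)).symm.append_adj hr
    (hx.hasPathOn hra ha) ?_, fun k hk hk0 => ?_⟩
  · rw [← Finset.image_union]
    refine Finset.image_subset_image fun i hi => ?_
    simp at hi ⊢
    omega
  · simp only [Finset.disjoint_left, Finset.mem_image, Finset.mem_Icc, not_exists, not_and]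
    rintro _ ⟨i, hi, rfl⟩ j hj hij
    have := hx.inj (by omega) (by omega) hij
    omega
  · rw [← Finset.image_union]
    refine Finset.mem_image_of_mem _ ?_
    simp only [Finset.mem_union, Finset.mem_Icc]
    rcases hk0 with rfl | hk0
    · omega
    · have := fun h => hmin k h hk0
      omega

/-- The vertex set of a longest path whose ends are adjacent is the whole connected graph. -/
lemma HasPathOn.eq_univ_of_adj [Fintype V] (hG : G.Connected) {u v : V} {U : Finset V}
    (h : G.HasPathOn u v U) (hvu : G.Adj v u)
    (hmax : ∀ u v W, G.HasPathOn u v W → W.card ≤ U.card) : U = Finset.univ := by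
  by_contra hne
  obtain ⟨y, hy⟩ : ∃ y, y ∉ U := by
    by_contra! hall
    exact hne (Finset.eq_univ_iff_forall.2 hall)
  obtain ⟨p⟩ := hG.preconnected u y
  obtain ⟨d, -, hd, hd'⟩ := p.exists_boundary_dart (U : Set V) h.start_mem hy
  obtain ⟨z, hz⟩ := h.exists_rotate hvu hd
  have := hmax _ _ _ (hz.cons d.adj.symm hd')
  rw [Finset.card_insert_of_notMem hd'] at this
  omega

namespace IsPathSeq

variable {x : ℕ → V} {m δ : ℕ} {N₀ N₁ : Finset ℕ}

/-- If some neighbour of `x m` precedes some neighbour of `x 0` on a longest path, there is a long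
cycle. -/
lemma exists_long_cycle_of_crossing [Fintype V] (hG : G.Connected) (hx : G.IsPathSeq x m)
    (hmax : ∀ u v W, G.HasPathOn u v W → W.card ≤ m + 1)
    (hN₀ : ∀ k, k ∈ N₀ ↔ k ≤ m ∧ G.Adj (x 0) (x k)) (hN₁ : ∀ k, k ∈ N₁ ↔ k ≤ m ∧ G.Adj (x m) (x k))
    (hcard₀ : δ ≤ N₀.card) (hcard₁ : δ ≤ N₁.card) (hlong : 3 ≤ min (Fintype.card V) (2 * δ))
    (hcross : ∃ i ∈ N₁, ∃ j ∈ N₀, i < j) :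
    ∃ (u : V) (c : G.Walk u u), c.IsCycle ∧ min (Fintype.card V) (2 * δ) ≤ c.length := by
  classical
  have hex : ∃ d, ∃ i ∈ N₁, ∃ j ∈ N₀, i < j ∧ j - i = d := by
    obtain ⟨i, hi, j, hj, hij⟩ := hcross
    exact ⟨_, i, hi, j, hj, hij, rfl⟩
  obtain ⟨i, hi, j, hj, hij, hd⟩ := Nat.find_spec hex
  have hmin : ∀ i' ∈ N₁, ∀ j' ∈ N₀, i' < j' → j - i ≤ j' - i' := fun i' hi' j' hj' h =>
    hd ▸ Nat.find_min' hex ⟨i', hi', j', hj', h, rfl⟩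
  have hjm := ((hN₀ j).1 hj).1
  have him : i ≠ m := by rintro rfl; exact G.irrefl ((hN₁ _).1 hi).2
  have h₀ : 0 ∉ N₀ := fun h => G.irrefl ((hN₀ _).1 h).2
  have hm : m ∉ N₁ := fun h => G.irrefl ((hN₁ _).1 h).2
  have hdisj : Disjoint (Finset.Icc 0 i) (Finset.Icc j m) := by
    rw [Finset.disjoint_left]
    intro k
    simp
    omega
  have hpath := (hx.hasPathOn (Nat.zero_le i) (by omega)).append_adj ((hN₁ i).1 hi).2.symm
    (hx.hasPathOn hjm le_rfl).symm (by
      simp only [Finset.disjoint_left, Finset.mem_image, Finset.mem_Icc, not_exists, not_and]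
      rintro _ ⟨k, hk, rfl⟩ l hl hkl
      have := hx.inj (by omega) (by omega) hkl
      omega)
  rw [← Finset.image_union] at hpath
  have hclose : G.Adj (x j) (x 0) := ((hN₀ j).1 hj).2.symm
  have hUcard : ((Finset.Icc 0 i ∪ Finset.Icc j m).image x).card = i + 1 + (m + 1 - j) := by
    rw [hx.card_image (by simp; omega), Finset.card_union_of_disjoint hdisj]
    simp
  have hle : min (Fintype.card V) (2 * δ) ≤ ((Finset.Icc 0 i ∪ Finset.Icc j m).image x).card := by
    rcases eq_or_ne j (i + 1) with hji | hji
    · refine (min_le_left _ _).trans ?_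
      rw [hpath.eq_univ_of_adj hG hclose fun u v W hW => (hmax u v W hW).trans (by omega),
        Finset.card_univ]
    · refine (min_le_right _ _).trans ?_
      have hpos : ∀ k ∈ N₀.erase j, 0 < k := fun k hk =>
        Nat.pos_of_ne_zero fun h => h₀ (h ▸ Finset.mem_of_mem_erase hk)
      have hcardP : ((N₀.erase j).image Nat.pred).card = N₀.card - 1 := by
        rw [Finset.card_image_of_injOn, Finset.card_erase_of_mem hj]
        intro k hk l hl hkl
        have := hpos k hk
        have := hpos l hl
        simp only [Nat.pred_eq_sub_one] at hkl
        omega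
      have hPN : Disjoint ((N₀.erase j).image Nat.pred) N₁ := by
        rw [Finset.disjoint_left]
        intro l hl hl'
        obtain ⟨k, hk, rfl⟩ := Finset.mem_image.1 hl
        have := hpos k hk
        have := hmin _ hl' k (Finset.mem_of_mem_erase hk) (by simp only [Nat.pred_eq_sub_one]; omega)
        simp only [Nat.pred_eq_sub_one] at this
        omega
      have hsub : (N₀.erase j).image Nat.pred ∪ N₁ ⊆ Finset.Icc 0 i ∪ Finset.Ico j m := by
        intro l hl
        simp only [Finset.mem_union, Finset.mem_Icc, Finset.mem_Ico]
        rcases Finset.mem_union.1 hl with hl | hl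
        · obtain ⟨k, hk, rfl⟩ := Finset.mem_image.1 hl
          have hkpos := hpos k hk
          obtain ⟨hkj, hk⟩ := Finset.mem_erase.1 hk
          have hkm := ((hN₀ k).1 hk).1
          have := hmin i hi k hk
          simp only [Nat.pred_eq_sub_one]
          omega
        · have hlm := ((hN₁ l).1 hl).1
          have : l ≠ m := by rintro rfl; exact hm hl
          have := hmin l hl j hj
          omega
      have := Finset.card_le_card hsub
      rw [Finset.card_union_of_disjoint hPN, hcardP] at this
      have := this.trans (Finset.card_union_le _ _)
      simp only [Nat.card_Icc, Nat.card_Ico] at this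
      omega
  obtain ⟨u, c, hc, hlen⟩ := hpath.exists_isCycle hclose (hlong.trans hle)
  exact ⟨u, c, hc, hlen ▸ hle⟩

/-- If no neighbour of `x m` precedes a neighbour of `x 0`, there is a cycle through `x 0`, `x m`
and all their neighbours on the path. -/
lemma exists_long_cycle_of_not_crossing (hG : ∀ v : V, (G.induce {w | w ≠ v}).Connected)
    (hx : G.IsPathSeq x m)
    (hN₀ : ∀ k, k ∈ N₀ ↔ k ≤ m ∧ G.Adj (x 0) (x k)) (hN₁ : ∀ k, k ∈ N₁ ↔ k ≤ m ∧ G.Adj (x m) (x k))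
    (hcard₀ : δ ≤ N₀.card) (hcard₁ : δ ≤ N₁.card) (hδ : 1 ≤ δ)
    (hcross : ∀ i ∈ N₁, ∀ j ∈ N₀, j ≤ i) :
    ∃ (u : V) (c : G.Walk u u), c.IsCycle ∧ 2 * δ ≤ c.length := by
  obtain ⟨a, ha, hamax⟩ := N₀.exists_max_image id (Finset.card_pos.1 (by omega))
  obtain ⟨b, hb, hbmin⟩ := N₁.exists_min_image id (Finset.card_pos.1 (by omega))
  simp only [id] at hamax hbmin
  have hab := hcross b hb a ha
  have h₀ : 0 ∉ N₀ := fun h => G.irrefl ((hN₀ _).1 h).2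
  have hm : m ∉ N₁ := fun h => G.irrefl ((hN₁ _).1 h).2
  obtain ⟨ham, hadja⟩ := (hN₀ a).1 ha
  obtain ⟨hbm, hadjb⟩ := (hN₁ b).1 hb
  have hapos : 0 < a := Nat.pos_of_ne_zero fun h => h₀ (h ▸ ha)
  have hbm' : b < m := lt_of_le_of_ne hbm fun h => hm (h ▸ hb)
  have hbase : G.IsCoveringSet x m ((insert 0 N₀).image x) a ((Finset.Icc 0 a).image x) := by
    refine ⟨Finset.mem_image_of_mem _ (by simp), fun k hk hkm hmem => ?_,
      ⟨x 0, Finset.mem_image_of_mem _ (by simp), hadja.ne⟩, fun z hz hza => ?_⟩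
    · obtain ⟨l, hl, hlk⟩ := Finset.mem_image.1 hmem
      rw [Finset.mem_Icc] at hl
      have := hx.inj (by omega) hkm hlk
      omega
    · obtain ⟨q, hq, rfl⟩ := Finset.mem_image.1 hz
      rw [Finset.mem_Icc] at hq
      have hqa : q ≠ a := by rintro rfl; exact hza rfl
      obtain ⟨F, hF, hpath, hcov⟩ := hx.exists_cover ham hadja (q := q) (by omega)
      refine ⟨F, hF, fun y hy => ?_, hpath⟩
      obtain ⟨k, hk, rfl⟩ := Finset.mem_image.1 hy
      rcases Finset.mem_insert.1 hk with rfl | hk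
      · exact hcov 0 (by omega) (.inl rfl)
      · exact hcov k (hamax k hk) (.inr ((hN₀ k).1 hk).2)
  obtain ⟨t, U, s, z, W, htb, hbs, hsm, hU, hz, hW, htW, hWU, hWx⟩ :=
    hbase.exists_jump hG hx hbm' hab
  have hzt : z ≠ x t := by rintro rfl; exact htW hW.start_mem
  obtain ⟨F, hFU, hSF, hF⟩ := hU.cover z hz hzt
  obtain ⟨F', hF', hpath', hcov'⟩ := hx.reverse.exists_cover (a := m - b) (q := m - s) (by omega)
    (by simpa [Nat.sub_sub_self hbm] using hadjb) (by omega)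
  simp only [Nat.sub_sub_self hbm, Nat.sub_sub_self hsm, Nat.sub_zero] at hpath' hcov'
  have hF'x : ∀ y ∈ F', ∃ k, b ≤ k ∧ k ≤ m ∧ y = x k := by
    intro y hy
    obtain ⟨k, hk, rfl⟩ := Finset.mem_image.1 (hF' hy)
    rw [Finset.mem_Icc] at hk
    exact ⟨m - k, by omega, by omega, rfl⟩
  have hnbr : ∀ k ∈ insert m N₁, x k ∈ F' := by
    intro k hk
    have hkm : b ≤ k ∧ k ≤ m := by
      rcases Finset.mem_insert.1 hk with rfl | hk
      · omega
      · exact ⟨hbmin k hk, ((hN₁ k).1 hk).1⟩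
    have := hcov' (m - k) (by omega)
    rw [Nat.sub_sub_self hkm.2] at this
    refine this ?_
    rcases Finset.mem_insert.1 hk with rfl | hk
    · exact .inl (by omega)
    · exact .inr ((hN₁ k).1 hk).2
  have hmid := hF.append (hx.hasPathOn htb hbm) fun y hy hy' =>
    hU.eq_of_mem_image_Icc hbm (hFU hy) hy'
  have hlong := hmid.append hpath'.symm (by
    intro y hy hy'
    obtain ⟨k, hbk, hkm, rfl⟩ := hF'x y hy'
    rcases Finset.mem_union.1 hy with hy | hy
    · by_contra hne
      have : k ≠ b := by rintro rfl; exact hne rfl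
      exact hU.notMem k (by omega) hkm (hFU hy)
    · obtain ⟨l, hl, hlk⟩ := Finset.mem_image.1 hy
      rw [Finset.mem_Icc] at hl
      have := hx.inj (by omega) hkm hlk
      rw [show k = b by omega])
  have hcard : 2 * δ + 1 ≤ (F ∪ (Finset.Icc t b).image x ∪ F').card := by
    have hsub : (insert 0 N₀ ∪ insert m N₁).image x ⊆ F ∪ (Finset.Icc t b).image x ∪ F' := by
      rw [Finset.image_union]
      refine Finset.union_subset (fun y hy => by simp [hSF hy]) fun y hy => ?_
      obtain ⟨k, hk, rfl⟩ := Finset.mem_image.1 hy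
      simp [hnbr k hk]
    refine le_trans ?_ (Finset.card_le_card hsub)
    have hle : ∀ k ∈ insert 0 N₀ ∪ insert m N₁, k ≤ m := by
      intro k hk
      simp only [Finset.mem_union, Finset.mem_insert] at hk
      rcases hk with (rfl | hk) | (rfl | hk)
      · omega
      · exact ((hN₀ k).1 hk).1
      · exact le_rfl
      · exact ((hN₁ k).1 hk).1
    rw [hx.card_image hle]
    have hinter : insert 0 N₀ ∩ insert m N₁ ⊆ {a} := by
      intro k hk
      simp only [Finset.mem_inter, Finset.mem_insert] at hk
      rw [Finset.mem_singleton]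
      have h1 : k ≤ a := by
        rcases hk.1 with rfl | hk
        · omega
        · exact hamax k hk
      have h2 : b ≤ k := by
        rcases hk.2 with rfl | hk
        · omega
        · exact hbmin k hk
      omega
    have h1 := Finset.card_le_card hinter
    have h2 := Finset.card_union_add_card_inter (insert 0 N₀) (insert m N₁)
    rw [Finset.card_insert_of_notMem h₀, Finset.card_insert_of_notMem hm] at h2
    rw [Finset.card_singleton] at h1
    omega
  obtain ⟨u, c, hc, hlen⟩ := hlong.exists_isCycle_of_disjoint hW
    (fun h => hU.notMem s (by omega) hsm (h ▸ hz)) (by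
      intro y hy hyW
      rcases Finset.mem_union.1 hy with hy | hy
      · rcases Finset.mem_union.1 hy with hy | hy
        · exact .inl (hWU y hyW (hFU hy))
        · obtain ⟨k, hk, rfl⟩ := Finset.mem_image.1 hy
          rw [Finset.mem_Icc] at hk
          have hkt : k ≠ t := by rintro rfl; exact htW hyW
          have := hWx k (by omega) (by omega) hyW
          omega
      · obtain ⟨k, hbk, hkm, rfl⟩ := hF'x y hy
        have hkt : k ≠ t := by rintro rfl; exact htW hyW
        exact .inr (by rw [hWx k (by omega) hkm hyW])) (by omega)
  exact ⟨u, c, hc, by omega⟩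

end IsPathSeq

lemma two_le_degree_of_connected_induce_ne [Fintype V] [DecidableRel G.Adj]
    (hcard : 3 ≤ Fintype.card V) (hconn : G.Connected)
    (hG : ∀ v : V, (G.induce {w | w ≠ v}).Connected) (v : V) : 2 ≤ G.degree v := by
  have : Nontrivial V := Fintype.one_lt_card_iff_nontrivial.1 (by omega)
  obtain ⟨w, hw⟩ := hconn.preconnected.exists_adj_of_nontrivial v
  obtain ⟨y, hy⟩ : ∃ y, y ∉ ({v, w} : Finset V) := by
    by_contra! h
    have := Finset.card_le_card (fun y _ => h y : Finset.univ ⊆ ({v, w} : Finset V))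
    have := this.trans Finset.card_le_two
    rw [Finset.card_univ] at this
    omega
  simp only [Finset.mem_insert, Finset.mem_singleton, not_or] at hy
  have : Nontrivial {u | u ≠ w} :=
    ⟨⟨v, hw.ne⟩, ⟨y, hy.2⟩, fun h => hy.1 (congrArg Subtype.val h).symm⟩
  obtain ⟨⟨w', hw'⟩, hadj⟩ := (hG w).preconnected.exists_adj_of_nontrivial ⟨v, hw.ne⟩
  rw [← card_neighborFinset_eq_degree]
  have : ({w, w'} : Finset V) ⊆ G.neighborFinset v := by
    intro u hu
    rcases Finset.mem_insert.1 hu with rfl | hu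
    · simpa using hw
    · rw [Finset.mem_singleton.1 hu]
      simpa using hadj
  rw [← Finset.card_pair (Ne.symm hw')]
  exact Finset.card_le_card this

/-- If all neighbours of `v` occur among `x 0, …, x m`, its degree is at most the number of indices
of its neighbours. -/
lemma degree_le_card_indices [Fintype V] [DecidableRel G.Adj] {x : ℕ → V} {m : ℕ} {v : V}
    (h : ∀ y, G.Adj v y → y ∈ (Finset.Icc 0 m).image x) :
    G.degree v ≤ ((Finset.Icc 0 m).filter fun k => G.Adj v (x k)).card := by
  rw [← card_neighborFinset_eq_degree]
  refine le_trans (Finset.card_le_card fun y hy => ?_) (Finset.card_image_le (f := x))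
  rw [mem_neighborFinset] at hy
  obtain ⟨k, hk, rfl⟩ := Finset.mem_image.1 (h y hy)
  exact Finset.mem_image_of_mem _ (Finset.mem_filter.2 ⟨hk, hy⟩)

/-- Every nonempty finite graph has a longest path. -/
lemma exists_longest_isPathSeq [Fintype V] [Nonempty V] (G : SimpleGraph V) :
    ∃ x m, G.IsPathSeq x m ∧ ∀ u v W, G.HasPathOn u v W → W.card ≤ m + 1 := by
  classical
  let v₀ : V := Classical.arbitrary V
  obtain ⟨U, hU, hmax⟩ := (Finset.univ.filter fun U : Finset V => ∃ u v, G.HasPathOn u v U)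
    |>.exists_max_image Finset.card ⟨{v₀}, by simpa using ⟨v₀, v₀, HasPathOn.singleton v₀⟩⟩
  simp only [Finset.mem_filter, Finset.mem_univ, true_and] at hU hmax
  obtain ⟨u, v, h⟩ := hU
  obtain ⟨x, m, hx, -, -, rfl⟩ := h.exists_isPathSeq
  rw [hx.card_image (by simp), Nat.card_Iic] at hmax
  exact ⟨x, m, hx, fun u v W hW => hmax W ⟨u, v, hW⟩⟩

end SimpleGraph

/-- Dirac: a 2-connected graph with minimum degree at least `δ` contains a cycle
of length at least `min n (2δ)`. -/
theorem stmt_6 {V : Type*} [Fintype V] [DecidableEq V] (G : SimpleGraph V)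
    [DecidableRel G.Adj] (δ : ℕ) (h2 : TwoConnected G)
    (hδ : ∀ v : V, δ ≤ G.degree v) :
    ∃ (u : V) (c : G.Walk u u), c.IsCycle ∧ min (Fintype.card V) (2 * δ) ≤ c.length := by
  obtain ⟨hn, hconn, hG⟩ := h2
  wlog h2δ : 2 ≤ δ generalizing δ
  · obtain ⟨u, c, hc, hlen⟩ :=
      this 2 (SimpleGraph.two_le_degree_of_connected_induce_ne hn hconn hG) le_rfl
    exact ⟨u, c, hc, le_trans (by omega) hlen⟩
  have := hconn.nonempty
  obtain ⟨x, m, hx, hmax⟩ := SimpleGraph.exists_longest_isPathSeq G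
  have hall := hx.hasPathOn (Nat.zero_le m) le_rfl
  have hallcard : ((Finset.Icc 0 m).image x).card = m + 1 := by
    rw [hx.card_image (by simp)]
    simp
  have hend : ∀ u v, G.HasPathOn u v ((Finset.Icc 0 m).image x) →
      ∀ y, G.Adj u y → y ∈ (Finset.Icc 0 m).image x := by
    intro u v h y hy
    by_contra hmem
    have := hmax _ _ _ (h.cons hy.symm hmem)
    rw [Finset.card_insert_of_notMem hmem] at this
    omega
  have hcard₀ := (hδ _).trans (SimpleGraph.degree_le_card_indices (hend _ _ hall))
  have hcard₁ := (hδ _).trans (SimpleGraph.degree_le_card_indices (hend _ _ hall.symm))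
  by_cases hcross : ∃ i ∈ (Finset.Icc 0 m).filter fun k => G.Adj (x m) (x k),
      ∃ j ∈ (Finset.Icc 0 m).filter fun k => G.Adj (x 0) (x k), i < j
  · exact hx.exists_long_cycle_of_crossing hconn hmax (by simp) (by simp) hcard₀ hcard₁
      (by omega) hcross
  · push Not at hcross
    obtain ⟨u, c, hc, hlen⟩ := hx.exists_long_cycle_of_not_crossing hG (by simp) (by simp)
      hcard₀ hcard₁ (by omega) hcross
    exact ⟨u, c, hc, (min_le_right _ _).trans hlen⟩
end

section
/- If G is a 2-connected graph and P is a path from x to y with ℓ vertices, then G contains a cycle of length at least min(ℓ, d(x,P) + d(y,P)), where d(v,P) denotes the number of neighbors of v among the vertices of P. -/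
namespace SimpleGraph

variable {V : Type*} [DecidableEq V] {G : SimpleGraph V}

/-- There is a path of `G` from `u` to `v` whose vertex set is exactly `A`. -/
def PathOn (G : SimpleGraph V) (u v : V) (A : Finset V) : Prop :=
  ∃ p : G.Walk u v, p.IsPath ∧ p.support.toFinset = A

namespace PathOn

variable {u v w z : V} {A B : Finset V}

lemma refl (u : V) : PathOn G u u {u} := ⟨Walk.nil, by simp, by simp⟩

lemma symm (h : PathOn G u v A) : PathOn G v u A := by
  obtain ⟨p, hp, rfl⟩ := h
  exact ⟨p.reverse, hp.reverse, by ext; simp⟩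

lemma start_mem (h : PathOn G u v A) : u ∈ A := by
  obtain ⟨p, hp, rfl⟩ := h
  simp

lemma end_mem (h : PathOn G u v A) : v ∈ A := h.symm.start_mem

lemma cons (h : PathOn G v w A) (huv : G.Adj u v) (hu : u ∉ A) :
    PathOn G u w (insert u A) := by
  obtain ⟨p, hp, rfl⟩ := h
  exact ⟨Walk.cons huv p, by simpa [hp] using hu, by simp⟩

lemma snoc (h : PathOn G u v A) (hvw : G.Adj v w) (hw : w ∉ A) :
    PathOn G u w (insert w A) :=
  (h.symm.cons hvw.symm hw).symm

lemma append (h : PathOn G u v A) (h' : PathOn G v w B)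
    (hAB : ∀ t ∈ A, t ∈ B → t = v) : PathOn G u w (A ∪ B) := by
  obtain ⟨p, hp, rfl⟩ := h
  induction p with
  | nil =>
    obtain ⟨q, hq, rfl⟩ := h'
    exact ⟨q, hq, by ext; simp⟩
  | @cons a b c hab p ih =>
    rw [Walk.cons_isPath_iff] at hp
    have key := ih h' hp.1 (fun t ht ht' => hAB t (by simp at ht ⊢; tauto) ht')
    have ha : a ∉ p.support.toFinset ∪ B := by
      intro ha
      rcases Finset.mem_union.1 ha with ha | ha
      · exact hp.2 (by simpa using ha)
      · have := hAB a (by simp) ha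
        subst this
        exact hp.2 p.end_mem_support
    convert key.cons hab ha using 1
    ext; simp

/-- A nontrivial path has a first edge. -/
lemma exists_adj_start (h : PathOn G u v A) (huv : u ≠ v) :
    ∃ w, G.Adj u w ∧ PathOn G w v (A.erase u) := by
  obtain ⟨p, hp, rfl⟩ := h
  cases p with
  | nil => exact absurd rfl huv
  | @cons _ b _ hab p =>
    rw [Walk.cons_isPath_iff] at hp
    refine ⟨b, hab, p, hp.1, ?_⟩
    have : u ∉ p.support.toFinset := by simpa using hp.2
    simp [this]

/-- A path can be split at any of its vertices. -/
lemma exists_split (h : PathOn G u v A) (hw : w ∈ A) :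
    ∃ B C, PathOn G u w B ∧ PathOn G w v C ∧ B ⊆ A ∧ C ⊆ A ∧ ∀ t ∈ B, t ∈ C → t = w := by
  obtain ⟨p, hp, rfl⟩ := h
  induction p with
  | nil =>
    simp only [Walk.support_nil, List.toFinset_cons, List.toFinset_nil, insert_empty_eq,
      Finset.mem_singleton] at hw
    subst hw
    exact ⟨{w}, {w}, refl w, refl w, by simp, by simp, by simp⟩
  | @cons a b c hab p ih =>
    rw [Walk.cons_isPath_iff] at hp
    by_cases hwa : w = a
    · subst hwa
      exact ⟨{w}, _, refl w, ⟨_, (Walk.cons_isPath_iff hab p).2 hp, rfl⟩, by simp, by simp,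
        by simp⟩
    · obtain ⟨B, C, hB, hC, hBA, hCA, hBC⟩ := ih hp.1 (by simp at hw ⊢; tauto)
      have ha : a ∉ p.support.toFinset := by simpa using hp.2
      refine ⟨insert a B, C, hB.cons hab fun h => ha (hBA h), hC, ?_, ?_, ?_⟩
      · simp only [Walk.support_cons, List.toFinset_cons]
        grind
      · simp only [Walk.support_cons, List.toFinset_cons]
        grind
      · grind

/-- A path reaching `T` contains an initial segment stopping at the first vertex of `T`. -/
lemma exists_first_mem (h : PathOn G u v A) {T : Finset V} (hv : v ∈ T) :
    ∃ w ∈ T, ∃ B, PathOn G u w B ∧ B ⊆ A ∧ ∀ t ∈ B, t ∈ T → t = w := by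
  obtain ⟨p, hp, rfl⟩ := h
  induction p with
  | @nil a => exact ⟨a, hv, {a}, refl a, by simp, by simp⟩
  | @cons a b c hab p ih =>
    rw [Walk.cons_isPath_iff] at hp
    by_cases ha : a ∈ T
    · exact ⟨a, ha, {a}, refl a, by simp, by simp⟩
    · obtain ⟨w, hw, B, hB, hBA, hBT⟩ := ih hv hp.1
      have ha' : a ∉ p.support.toFinset := by simpa using hp.2
      refine ⟨w, hw, insert a B, hB.cons hab fun h => ha' (hBA h), ?_, ?_⟩
      · simp only [Walk.support_cons, List.toFinset_cons]
        grind
      · grind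

/-- A path on at least three vertices with adjacent ends closes to a cycle. -/
lemma exists_isCycle (h : PathOn G u v A) (hvu : G.Adj v u) (hA : 3 ≤ A.card) :
    ∃ (z : V) (c : G.Walk z z), c.IsCycle ∧ c.length = A.card := by
  obtain ⟨p, hp, rfl⟩ := h
  have hlen : p.support.toFinset.card = p.length + 1 := by
    rw [List.toFinset_card_of_nodup hp.support_nodup, Walk.length_support]
  refine ⟨v, Walk.cons hvu p, ?_, by simp [hlen]⟩
  rw [Walk.cons_isCycle_iff]
  refine ⟨hp, fun he => ?_⟩
  cases p with
  | nil => exact hvu.ne rfl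
  | @cons _ b _ hub q =>
    rw [Walk.cons_isPath_iff] at hp
    rw [Walk.edges_cons, List.mem_cons] at he
    rcases he with he | he
    · have hb : b = v := by
        have := hub.ne
        have := hvu.ne
        simp only [Sym2.eq_iff] at he
        grind
      subst hb
      have := Walk.eq_nil_iff_nil.2 (Walk.isPath_iff_nil.1 hp.1)
      subst this
      simp at hlen hA
      omega
    · exact hp.2 (Walk.snd_mem_support_of_mem_edges q he)

/-- Two paths with the same ends and otherwise disjoint form a cycle. -/
lemma exists_isCycle_of_inter (h : PathOn G u v A) (h' : PathOn G u v B) (huv : u ≠ v)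
    (hAB : ∀ t ∈ A, t ∈ B → t = u ∨ t = v) (hcard : 3 ≤ (A ∪ B).card) :
    ∃ (z : V) (c : G.Walk z z), c.IsCycle ∧ c.length = (A ∪ B).card := by
  obtain ⟨w, hw, hB⟩ := h'.exists_adj_start huv
  have hE : A ∪ B.erase u = A ∪ B := by
    have := h.start_mem
    grind
  have key := h.append hB.symm (by grind)
  rw [hE] at key
  exact key.exists_isCycle hw.symm hcard

end PathOn

/-- If deleting `z` leaves `G` connected, then any two sets avoiding `z` are joined by a path
avoiding `z` and meeting each of the sets only in its respective end. -/
lemma exists_pathOn_of_connected_induce {z : V} (hz : (G.induce {w | w ≠ z}).Connected)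
    {S T : Finset V} (hS : S.Nonempty) (hT : T.Nonempty) (hzS : z ∉ S) (hzT : z ∉ T) :
    ∃ a ∈ S, ∃ b ∈ T, ∃ C, PathOn G a b C ∧ z ∉ C ∧
      (∀ t ∈ C, t ∈ S → t = a) ∧ (∀ t ∈ C, t ∈ T → t = b) := by
  obtain ⟨a, ha⟩ := hS
  obtain ⟨b, hb⟩ := hT
  obtain ⟨p, hp⟩ := (hz.preconnected ⟨a, fun h => hzS (h ▸ ha)⟩
    ⟨b, fun h => hzT (h ▸ hb)⟩).exists_isPath
  let f : G.induce {w | w ≠ z} ↪g G := Embedding.induce _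
  have h0 : PathOn G a b (p.map f.toHom).support.toFinset :=
    ⟨p.map f.toHom, hp.map f.injective, rfl⟩
  have hz0 : z ∉ (p.map f.toHom).support.toFinset := by
    rw [List.mem_toFinset, Walk.support_map, List.mem_map]
    rintro ⟨t, -, ht⟩
    exact t.2 ht
  obtain ⟨b', hb', B, hB, hBA, hBT⟩ := h0.exists_first_mem hb
  obtain ⟨a', ha', C, hC, hCB, hCS⟩ := hB.symm.exists_first_mem ha
  exact ⟨a', ha', b', hb', C, hC.symm, fun h => hz0 (hBA (hCB h)), hCS,
    fun t ht ht' => hBT t (hCB ht) ht'⟩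

/-- Two disjoint paths from `S` to `T`, internally disjoint from `S ∪ T`, such that `s` is one of
the two starting points and `u` is one of the two end points. -/
def Linked (G : SimpleGraph V) (S T : Finset V) (s u : V) : Prop :=
  ∃ a c e f Q R, a ∈ S ∧ a ≠ s ∧ c ∈ T ∧ c ≠ u ∧ PathOn G s e Q ∧ PathOn G a f R ∧
    Disjoint Q R ∧ ((e = u ∧ f = c) ∨ (e = c ∧ f = u)) ∧
    (∀ t ∈ Q, t ∈ S → t = s) ∧ (∀ t ∈ R, t ∈ S → t = a) ∧
    (∀ t ∈ Q, t ∈ T → t = e) ∧ (∀ t ∈ R, t ∈ T → t = f)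

lemma Linked.step {S T : Finset V} {s u u' : V} (h : Linked G S T s u) (hs : s ∈ S)
    (hadj : G.Adj u u') (hu' : u' ∈ T) (hST : Disjoint S (T.erase u))
    (hne : ((T.erase u).erase u').Nonempty) (hconn : (G.induce {w | w ≠ u'}).Connected) :
    Linked G S (T.erase u) s u' := by
  obtain ⟨a, c, e, f, Q, R, ha, has, hc, hcu, hQ, hR, hQR, hef, hQS, hRS, hQT, hRT⟩ := h
  have huu' : u' ≠ u := hadj.ne'
  have hQs := hQ.start_mem
  have hQe := hQ.end_mem
  have hRs := hR.start_mem
  have hRe := hR.end_mem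
  rw [Finset.disjoint_left] at hST hQR
  by_cases hcu' : c = u'
  · obtain ⟨w, hw, r, hr, C, hC, hu'C, hCw, hCr⟩ := exists_pathOn_of_connected_induce hconn
      (S := (S ∪ (Q ∪ R)).erase u') (T := (T.erase u).erase u')
      ⟨s, by grind⟩ hne (by simp) (by simp)
    have hCs := hC.start_mem
    have hCe := hC.end_mem
    rcases hef with ⟨rfl, rfl⟩ | ⟨rfl, rfl⟩
    · by_cases hwQ : w ∈ Q
      · obtain ⟨B, D, hB, hD, hBQ, hDQ, hBD⟩ := hQ.exists_split hwQ
        exact ⟨a, r, r, f, B ∪ C, R, ha, has, by grind, by grind, hB.append hC (by grind), hR,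
          by rw [Finset.disjoint_left]; grind, by grind, by grind, by grind, by grind, by grind⟩
      by_cases hwR : w ∈ R
      · obtain ⟨B, D, hB, hD, hBR, hDR, hBD⟩ := hR.exists_split hwR
        have := hD.end_mem
        exact ⟨a, r, u', r, insert u' Q, B ∪ C, ha, has, by grind, by grind,
          hQ.snoc hadj (by grind), hB.append hC (by grind),
          by rw [Finset.disjoint_left]; grind, by grind, by grind, by grind, by grind, by grind⟩
      · exact ⟨w, r, u', r, insert u' Q, C, by grind, by grind, by grind, by grind,
          hQ.snoc hadj (by grind), hC,
          by rw [Finset.disjoint_left]; grind, by grind, by grind, by grind, by grind, by grind⟩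
    · by_cases hwQ : w ∈ Q
      · obtain ⟨B, D, hB, hD, hBQ, hDQ, hBD⟩ := hQ.exists_split hwQ
        have := hD.end_mem
        exact ⟨a, r, r, u', B ∪ C, insert u' R, ha, has, by grind, by grind,
          hB.append hC (by grind), hR.snoc hadj (by grind),
          by rw [Finset.disjoint_left]; grind, by grind, by grind, by grind, by grind, by grind⟩
      by_cases hwR : w ∈ R
      · obtain ⟨B, D, hB, hD, hBR, hDR, hBD⟩ := hR.exists_split hwR
        exact ⟨a, r, e, r, Q, B ∪ C, ha, has, by grind, by grind, hQ, hB.append hC (by grind),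
          by rw [Finset.disjoint_left]; grind, by grind, by grind, by grind, by grind, by grind⟩
      · exact ⟨w, r, e, r, Q, C, by grind, by grind, by grind, by grind, hQ, hC,
          by rw [Finset.disjoint_left]; grind, by grind, by grind, by grind, by grind, by grind⟩
  · rcases hef with ⟨rfl, rfl⟩ | ⟨rfl, rfl⟩
    · exact ⟨a, f, u', f, insert u' Q, R, ha, has, by grind, by grind,
        hQ.snoc hadj (by grind), hR, by rw [Finset.disjoint_left]; grind,
        by grind, by grind, by grind, by grind, by grind⟩
    · exact ⟨a, e, e, u', Q, insert u' R, ha, has, by grind, by grind,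
        hQ, hR.snoc hadj (by grind), by rw [Finset.disjoint_left]; grind,
        by grind, by grind, by grind, by grind, by grind⟩

section Sequence

variable {v : ℕ → V} {m : ℕ}

lemma pathOn_image_Icc (hinj : ∀ i ≤ m, ∀ j ≤ m, v i = v j → i = j)
    (hadj : ∀ i < m, G.Adj (v i) (v (i + 1))) {i j : ℕ} (hij : i ≤ j) (hj : j ≤ m) :
    PathOn G (v i) (v j) ((Finset.Icc i j).image v) := by
  induction j, hij using Nat.le_induction with
  | base => simpa using PathOn.refl (v i)
  | succ j hij ih =>
    have hnot : v (j + 1) ∉ (Finset.Icc i j).image v := by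
      intro h
      obtain ⟨k, hk, hkj⟩ := Finset.mem_image.1 h
      rw [Finset.mem_Icc] at hk
      have := hinj k (by omega) (j + 1) hj hkj
      omega
    convert (ih (by omega)).snoc (hadj j (by omega)) hnot using 1
    rw [← Finset.image_insert]
    congr 1
    ext k
    simp only [Finset.mem_Icc, Finset.mem_insert]
    omega

/-- If `v 0` is adjacent to `v s`, then inside the first `s + 1` vertices any earlier vertex is
joined to `v s` by a path through `v 0` and all neighbours of `v 0`. -/
lemma exists_pathOn_through_neighbors (hinj : ∀ i ≤ m, ∀ j ≤ m, v i = v j → i = j)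
    (hadj : ∀ i < m, G.Adj (v i) (v (i + 1))) {a s : ℕ} (has : a < s) (hs : s ≤ m)
    (h0s : G.Adj (v 0) (v s)) :
    ∃ D ⊆ (Finset.Icc 0 s).image v, PathOn G (v a) (v s) D ∧ v 0 ∈ D ∧
      ∀ j ≤ s, G.Adj (v 0) (v j) → v j ∈ D := by
  classical
  have hex : ∃ b, a < b ∧ G.Adj (v 0) (v b) := ⟨s, has, h0s⟩
  obtain ⟨hab, h0b⟩ := Nat.find_spec hex
  have hmin := fun k (hk : k < Nat.find hex) => Nat.find_min hex hk
  have hbs : Nat.find hex ≤ s := Nat.find_min' hex ⟨has, h0s⟩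
  generalize Nat.find hex = b at hab h0b hmin hbs
  have hlow := pathOn_image_Icc hinj hadj (Nat.zero_le a) (by omega)
  have hhigh := pathOn_image_Icc hinj hadj hbs hs
  have hdisj : ∀ t ∈ (Finset.Icc 0 a).image v, t ∉ (Finset.Icc b s).image v := by
    simp only [Finset.mem_image, Finset.mem_Icc]
    rintro t ⟨i, hi, rfl⟩ ⟨j, hj, hji⟩
    have := hinj j (by omega) i (by omega) hji
    omega
  have h0 : v 0 ∈ (Finset.Icc 0 a).image v := hlow.start_mem
  refine ⟨_, ?_, hlow.symm.append (hhigh.cons h0b (hdisj _ h0)) ?_, by simp [h0], ?_⟩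
  · intro t ht
    simp only [Finset.mem_union, Finset.mem_insert, Finset.mem_image, Finset.mem_Icc] at ht ⊢
    rcases ht with ⟨i, hi, rfl⟩ | rfl | ⟨i, hi, rfl⟩
    · exact ⟨i, by omega, rfl⟩
    · exact ⟨0, by omega, rfl⟩
    · exact ⟨i, by omega, rfl⟩
  · intro t ht ht'
    rcases Finset.mem_insert.1 ht' with h | h
    · exact h
    · exact absurd h (hdisj t ht)
  · intro j hj h0j
    simp only [Finset.mem_union, Finset.mem_insert, Finset.mem_image, Finset.mem_Icc]
    by_cases hja : j ≤ a
    · exact Or.inl ⟨j, by omega, rfl⟩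
    · refine Or.inr (Or.inr ⟨j, ⟨?_, hj⟩, rfl⟩)
      by_contra hjb
      exact hmin j (by omega) ⟨by omega, h0j⟩

lemma linked_image_Icc (hinj : ∀ i ≤ m, ∀ j ≤ m, v i = v j → i = j)
    (hadj : ∀ i < m, G.Adj (v i) (v (i + 1)))
    (hconn : ∀ z, (G.induce {w | w ≠ z}).Connected) {s t : ℕ} (hs : 0 < s) (hst : s ≤ t)
    (ht : t < m) :
    Linked G ((Finset.Icc 0 s).image v) ((Finset.Icc t m).image v) (v s) (v t) := by
  have herase : ∀ i < m, ((Finset.Icc i m).image v).erase (v i) =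
      (Finset.Icc (i + 1) m).image v := by
    intro i hi
    ext w
    simp only [Finset.mem_erase, Finset.mem_image, Finset.mem_Icc]
    constructor
    · rintro ⟨hw, k, hk, rfl⟩
      have : k ≠ i := fun h => hw (h ▸ rfl)
      exact ⟨k, by omega, rfl⟩
    · rintro ⟨k, hk, rfl⟩
      refine ⟨fun h => ?_, k, by omega, rfl⟩
      have := hinj k (by omega) i (by omega) h
      omega
  have hdisj : ∀ i, s ≤ i → Disjoint ((Finset.Icc 0 s).image v)
      ((Finset.Icc (i + 1) m).image v) := by
    intro i hi
    rw [Finset.disjoint_left]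
    simp only [Finset.mem_image, Finset.mem_Icc]
    rintro w ⟨j, hj, rfl⟩ ⟨k, hk, hkj⟩
    have := hinj k (by omega) j (by omega) hkj
    omega
  have hmem : ∀ i ≤ m, v m ∈ (Finset.Icc i m).image v := fun i hi =>
    Finset.mem_image_of_mem v (by simp [hi])
  induction t, hst using Nat.le_induction with
  | base =>
    have h0s : v 0 ≠ v s := fun h => by
      have := hinj 0 (by omega) s (by omega) h
      omega
    obtain ⟨a, ha, b, hb, C, hC, hsC, hCa, hCb⟩ := exists_pathOn_of_connected_induce (hconn (v s))
      (S := ((Finset.Icc 0 s).image v).erase (v s))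
      (T := ((Finset.Icc s m).image v).erase (v s))
      ⟨v 0, Finset.mem_erase.2 ⟨h0s, Finset.mem_image_of_mem v (by simp)⟩⟩
      ⟨v m, by rw [herase s ht]; exact hmem _ ht⟩ (by simp) (by simp)
    exact ⟨a, b, v s, b, {v s}, C, by grind, by grind, by grind, by grind, PathOn.refl _, hC,
      by simpa using hsC, by grind, by grind, by grind, by grind, by grind⟩
  | succ t hst ih =>
    rw [← herase t (by omega)]
    refine (ih (by omega)).step (Finset.mem_image_of_mem v (by simp)) (hadj t (by omega))
      (Finset.mem_image_of_mem v (by simp; omega)) ?_ ?_ (hconn _)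
    · rw [herase t (by omega)]
      exact hdisj t hst
    · rw [herase t (by omega), herase (t + 1) ht]
      exact ⟨_, hmem _ ht⟩

/-- The case in which every neighbour of `v 0` precedes every neighbour of `v m`. -/
lemma exists_isCycle_of_not_crossing (hinj : ∀ i ≤ m, ∀ j ≤ m, v i = v j → i = j)
    (hadj : ∀ i < m, G.Adj (v i) (v (i + 1)))
    (hconn : ∀ z, (G.induce {w | w ≠ z}).Connected) {s t : ℕ} (hs : 0 < s) (hst : s ≤ t)
    (ht : t < m) (h0s : G.Adj (v 0) (v s)) (hmt : G.Adj (v m) (v t)) {M N : Finset V}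
    (hM : ∀ w ∈ M, G.Adj (v 0) w ∧ ∃ j ≤ s, v j = w)
    (hN : ∀ w ∈ N, G.Adj (v m) w ∧ ∃ j ≤ m, t ≤ j ∧ v j = w) :
    ∃ (z : V) (c : G.Walk z z), c.IsCycle ∧ M.card + N.card ≤ c.length := by
  obtain ⟨a, c, e, f, Q, R, ha, has, hc, hcu, hQ, hR, hQR, hef, hQS, hRS, hQT, hRT⟩ :=
    linked_image_Icc hinj hadj hconn hs hst ht
  rw [Finset.disjoint_left] at hQR
  have hST : ∀ w ∈ (Finset.Icc 0 s).image v, w ∈ (Finset.Icc t m).image v →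
      w = v s ∧ w = v t := by
    simp only [Finset.mem_image, Finset.mem_Icc]
    rintro w ⟨j, hj, rfl⟩ ⟨k, hk, hkj⟩
    have := hinj k (by omega) j (by omega) hkj
    have hjs : j = s := by omega
    have hjt : j = t := by omega
    exact ⟨hjs ▸ rfl, hjt ▸ rfl⟩
  obtain ⟨i, hi, rfl⟩ := Finset.mem_image.1 ha
  obtain ⟨k, hk, rfl⟩ := Finset.mem_image.1 hc
  rw [Finset.mem_Icc] at hi hk
  have his : i ≠ s := fun h => has (h ▸ rfl)
  have hkt : k ≠ t := fun h => hcu (h ▸ rfl)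
  obtain ⟨D, hDS, hD, h0D, hMD⟩ :=
    exists_pathOn_through_neighbors hinj hadj (a := i) (s := s) (by omega) (by omega) h0s
  obtain ⟨E, hET, hE, hmE, hNE⟩ :=
    exists_pathOn_through_neighbors (G := G) (v := fun j => v (m - j)) (m := m) (a := m - k)
      (s := m - t) (fun i hi j hj h => by
        have := hinj (m - i) (by omega) (m - j) (by omega) h
        omega)
      (fun i hi => by
        have := hadj (m - (i + 1)) (by omega)
        rw [show m - (i + 1) + 1 = m - i by omega] at this
        exact this.symm)
      (by omega) (by omega) (by
        simpa [show m - (m - t) = t by omega] using hmt)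
  have hET' : E ⊆ (Finset.Icc t m).image v := by
    intro w hw
    obtain ⟨j, hj, rfl⟩ := Finset.mem_image.1 (hET hw)
    rw [Finset.mem_Icc] at hj
    exact Finset.mem_image_of_mem v (by rw [Finset.mem_Icc]; omega)
  simp only [show m - (m - k) = k by omega, show m - (m - t) = t by omega, Nat.sub_zero]
    at hE hmE
  have hME : insert (v 0) M ⊆ D := by
    intro w hw
    rcases Finset.mem_insert.1 hw with rfl | hw
    · exact h0D
    · obtain ⟨h0w, j, hj, rfl⟩ := hM w hw
      exact hMD j hj h0w
  have hNE' : insert (v m) N ⊆ E := by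
    intro w hw
    rcases Finset.mem_insert.1 hw with rfl | hw
    · exact hmE
    · obtain ⟨hmw, j, hj, htj, rfl⟩ := hN w hw
      have := hNE (m - j) (by omega)
      simp only [show m - (m - j) = j by omega, Nat.sub_zero] at this
      exact this hmw
  have hMc : M.card + 1 ≤ D.card := by
    rw [← Finset.card_insert_of_notMem (fun h => (hM _ h).1.ne rfl)]
    exact Finset.card_le_card hME
  have hNc : N.card + 1 ≤ E.card := by
    rw [← Finset.card_insert_of_notMem (fun h => (hN _ h).1.ne rfl)]
    exact Finset.card_le_card hNE'
  have hD2 : 2 ≤ D.card :=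
    Finset.one_lt_card.2 ⟨_, hD.start_mem, _, hD.end_mem, has⟩
  have hE2 : 2 ≤ E.card :=
    Finset.one_lt_card.2 ⟨_, hE.start_mem, _, hE.end_mem, hcu⟩
  have hDE : (D ∩ E).card ≤ 1 := by
    rw [Finset.card_le_one]
    intro w hw w' hw'
    rw [Finset.mem_inter] at hw hw'
    rw [(hST w (hDS hw.1) (hET' hw.2)).1, (hST w' (hDS hw'.1) (hET' hw'.2)).1]
  have hcard := Finset.card_union_add_card_inter D E
  have hQs := hQ.start_mem
  have hQe := hQ.end_mem
  have hRs := hR.start_mem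
  have hRe := hR.end_mem
  have hEe : PathOn G e f E := by
    rcases hef with ⟨rfl, rfl⟩ | ⟨rfl, rfl⟩
    · exact hE.symm
    · exact hE
  have hef' : e ∈ (Finset.Icc t m).image v ∧ f ∈ (Finset.Icc t m).image v :=
    ⟨hET' hEe.start_mem, hET' hEe.end_mem⟩
  have hDQ := hD.append hQ (fun w hw hw' => hQS w hw' (hDS hw))
  have hDQE := hDQ.append hEe (by
    intro w hw hw'
    rcases Finset.mem_union.1 hw with hw | hw
    · have := hST w (hDS hw) (hET' hw')
      grind
    · exact hQT w hw (hET' hw'))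
  have hle : (D ∪ E).card ≤ (D ∪ Q ∪ E ∪ R).card := Finset.card_le_card (by grind)
  obtain ⟨z, c, hc, hlen⟩ := hDQE.exists_isCycle_of_inter hR
    (fun h => has (hST _ ha (h ▸ hef'.2)).1) (by grind) (by omega)
  exact ⟨z, c, hc, by omega⟩

/-- The case in which some neighbour of `v 0` comes after some neighbour of `v m`. -/
lemma exists_isCycle_of_crossing [DecidableRel G.Adj]
    (hinj : ∀ i ≤ m, ∀ j ≤ m, v i = v j → i = j)
    (hadj : ∀ i < m, G.Adj (v i) (v (i + 1))) (hm : 2 ≤ m)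
    (hcross : ∃ d, 0 < d ∧ ∃ i, i + d ≤ m ∧ G.Adj (v m) (v i) ∧ G.Adj (v 0) (v (i + d))) :
    ∃ (z : V) (c : G.Walk z z), c.IsCycle ∧
      min (m + 1) (((Finset.range (m + 1)).filter (fun j => G.Adj (v 0) (v j))).card +
        ((Finset.range (m + 1)).filter (fun j => G.Adj (v m) (v j))).card) ≤ c.length := by
  have hcardIcc : ∀ i j, j ≤ m → ((Finset.Icc i j).image v).card = j + 1 - i := by
    intro i j hj
    rw [Finset.card_image_of_injOn, Nat.card_Icc]
    intro k hk l hl h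
    simp only [Finset.coe_Icc, Set.mem_Icc] at hk hl
    exact hinj k (by omega) l (by omega) h
  by_cases h0m : G.Adj (v m) (v 0)
  · obtain ⟨z, c, hc, hlen⟩ := (pathOn_image_Icc hinj hadj (Nat.zero_le m) le_rfl).exists_isCycle
      h0m (by rw [hcardIcc 0 m le_rfl]; omega)
    rw [hcardIcc 0 m le_rfl] at hlen
    exact ⟨z, c, hc, by omega⟩
  classical
  obtain ⟨hd, i, hid, hmi, h0i⟩ := Nat.find_spec hcross
  have hmin := fun k (hk : k < Nat.find hcross) => Nat.find_min hcross hk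
  generalize Nat.find hcross = d at hd hid h0i hmin
  have hlow := pathOn_image_Icc hinj hadj (Nat.zero_le i) (by omega)
  have hhigh := pathOn_image_Icc hinj hadj hid le_rfl
  have hdisj : Disjoint ((Finset.Icc 0 i).image v) ((Finset.Icc (i + d) m).image v) := by
    rw [Finset.disjoint_left]
    simp only [Finset.mem_image, Finset.mem_Icc]
    rintro t ⟨j, hj, rfl⟩ ⟨k, hk, hkj⟩
    have := hinj k (by omega) j (by omega) hkj
    omega
  have hpath := hlow.append (hhigh.symm.cons hmi.symm
      (Finset.disjoint_left.1 hdisj hlow.end_mem)) (by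
    intro t ht ht'
    rcases Finset.mem_insert.1 ht' with h | h
    · exact h
    · exact absurd h (Finset.disjoint_left.1 hdisj ht))
  have hset : (Finset.Icc 0 i).image v ∪ insert (v i) ((Finset.Icc (i + d) m).image v) =
      (Finset.Icc 0 i).image v ∪ (Finset.Icc (i + d) m).image v := by
    have := hlow.end_mem
    grind
  rw [hset] at hpath
  have hcard : ((Finset.Icc 0 i).image v ∪ (Finset.Icc (i + d) m).image v).card =
      i + 1 + (m + 1 - (i + d)) := by
    rw [Finset.card_union_of_disjoint hdisj, hcardIcc _ _ (by omega), hcardIcc _ _ le_rfl]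
    omega
  have hlong : ¬ (i = 0 ∧ i + d = m) := by
    rintro ⟨rfl, h⟩
    exact h0m hmi
  obtain ⟨z, c, hc, hlen⟩ := hpath.exists_isCycle h0i.symm (by omega)
  refine ⟨z, c, hc, ?_⟩
  by_cases hd1 : d = 1
  · omega
  refine (min_le_right _ _).trans ?_
  set A := (Finset.range (m + 1)).filter (fun j => G.Adj (v 0) (v j)) with hA
  set B := (Finset.range (m + 1)).filter (fun j => G.Adj (v m) (v j)) with hB
  have hApos : ∀ j ∈ A, j ≤ m ∧ 0 < j ∧ G.Adj (v 0) (v j) := by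
    intro j hj
    rw [hA, Finset.mem_filter, Finset.mem_range] at hj
    refine ⟨by omega, Nat.pos_of_ne_zero ?_, hj.2⟩
    rintro rfl
    exact hj.2.ne rfl
  have hBlt : ∀ j ∈ B, j < m ∧ G.Adj (v m) (v j) := by
    intro j hj
    rw [hB, Finset.mem_filter, Finset.mem_range] at hj
    refine ⟨lt_of_le_of_ne (by omega) ?_, hj.2⟩
    rintro rfl
    exact hj.2.ne rfl
  have hAcard : (A.image (· - 1)).card = A.card := by
    refine Finset.card_image_of_injOn fun j hj k hk h => ?_
    have := hApos j hj
    have := hApos k hk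
    omega
  have hAB : Disjoint (A.image (· - 1)) B := by
    rw [Finset.disjoint_left]
    intro k hk hkB
    obtain ⟨j, hj, rfl⟩ := Finset.mem_image.1 hk
    obtain ⟨hjm, hj0, h0j⟩ := hApos j hj
    refine hmin 1 (by omega) ⟨one_pos, j - 1, by omega, (hBlt _ hkB).2, ?_⟩
    rwa [Nat.sub_add_cancel hj0]
  have hsub : A.image (· - 1) ∪ B ⊆ Finset.Icc 0 i ∪ Finset.Icc (i + d - 1) (m - 1) := by
    intro k hk
    rw [Finset.mem_union, Finset.mem_Icc, Finset.mem_Icc]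
    by_contra hcon
    rcases Finset.mem_union.1 hk with hk | hk
    · obtain ⟨j, hj, rfl⟩ := Finset.mem_image.1 hk
      obtain ⟨hjm, hj0, h0j⟩ := hApos j hj
      refine hmin (j - i) (by omega) ⟨by omega, i, by omega, hmi, ?_⟩
      rwa [show i + (j - i) = j by omega]
    · obtain ⟨hkm, hmk⟩ := hBlt k hk
      refine hmin (i + d - k) (by omega) ⟨by omega, k, by omega, hmk, ?_⟩
      rwa [show k + (i + d - k) = i + d by omega]
  have h1 := Finset.card_le_card hsub
  have h2 := Finset.card_union_le (Finset.Icc 0 i) (Finset.Icc (i + d - 1) (m - 1))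
  rw [Finset.card_union_of_disjoint hAB, hAcard] at h1
  rw [Nat.card_Icc, Nat.card_Icc] at h2
  omega

end Sequence

lemma exists_isCycle_of_connected_induce [Fintype V] (hV : 3 ≤ Fintype.card V)
    (hconn : ∀ z, (G.induce {w | w ≠ z}).Connected) :
    ∃ (z : V) (c : G.Walk z z), c.IsCycle := by
  have hnbr : ∀ u z : V, u ≠ z → ∃ w, w ≠ z ∧ G.Adj u w := by
    intro u z huz
    obtain ⟨w, hw⟩ := Finset.exists_mem_notMem_of_card_lt_card (s := {u, z})
      (t := (Finset.univ : Finset V)) (by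
        rw [Finset.card_univ]; exact Finset.card_le_two.trans_lt hV)
    obtain ⟨a, ha, b, hb, C, hC, hzC, -, -⟩ := exists_pathOn_of_connected_induce (hconn z)
      (S := {u}) (T := {w}) (by simp) (by simp) (by grind) (by grind)
    obtain ⟨x, hx, hxC⟩ := hC.exists_adj_start (by grind)
    have := hxC.start_mem
    exact ⟨x, by grind, by grind⟩
  obtain ⟨u, z, huz⟩ := Fintype.exists_pair_of_one_lt_card (by omega : 1 < Fintype.card V)
  obtain ⟨b, -, hub⟩ := hnbr u z huz
  obtain ⟨c, hcb, huc⟩ := hnbr u b hub.ne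
  obtain ⟨b', hb', c', hc', C, hC, huC, -, -⟩ := exists_pathOn_of_connected_induce (hconn u)
    (S := {b}) (T := {c}) (by simp) (by simp) (by simpa using hub.ne) (by simpa using huc.ne)
  rw [Finset.mem_singleton] at hb' hc'
  subst hb' hc'
  have hcard : 2 ≤ C.card := Finset.one_lt_card.2 ⟨_, hC.start_mem, _, hC.end_mem, hcb.symm⟩
  obtain ⟨z, c, hc, -⟩ := (hC.cons hub huC).exists_isCycle huc.symm
    (by rw [Finset.card_insert_of_notMem huC]; omega)
  exact ⟨z, c, hc⟩

end SimpleGraph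

open SimpleGraph in
/-- Kopylov: if `G` is 2-connected and `P` is an `x,y`-path on `ℓ` vertices, then
`G` has a cycle of length at least `min ℓ (d(x,P) + d(y,P))`, where `d(v,P)` is
the number of neighbors of `v` among the vertices of `P`. -/
theorem stmt_7 {V : Type*} [Fintype V] [DecidableEq V] (G : SimpleGraph V)
    [DecidableRel G.Adj] (h2 : TwoConnected G) (x y : V) (p : G.Walk x y)
    (hp : p.IsPath) (ℓ : ℕ) (hl : p.length + 1 = ℓ) :
    ∃ (u : V) (c : G.Walk u u), c.IsCycle ∧
      min ℓ ((p.support.toFinset.filter (fun w => G.Adj x w)).card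
        + (p.support.toFinset.filter (fun w => G.Adj y w)).card) ≤ c.length := by
  obtain ⟨hV, -, hconn⟩ := h2
  by_cases hm : p.length < 2
  · obtain ⟨z, c, hc⟩ := exists_isCycle_of_connected_induce hV hconn
    have := hc.three_le_length
    exact ⟨z, c, hc, (min_le_left _ _).trans (by omega)⟩
  rw [not_lt] at hm
  have hinj : ∀ i ≤ p.length, ∀ j ≤ p.length, p.getVert i = p.getVert j → i = j :=
    fun i hi j hj h => hp.getVert_injOn hi hj h
  have hadj : ∀ i < p.length, G.Adj (p.getVert i) (p.getVert (i + 1)) :=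
    fun i hi => p.adj_getVert_succ hi
  have hv0 : p.getVert 0 = x := p.getVert_zero
  have hvm : p.getVert p.length = y := p.getVert_length
  have hsupp : p.support.toFinset = (Finset.range (p.length + 1)).image p.getVert := by
    ext w
    simp only [List.mem_toFinset, Walk.mem_support_iff_exists_getVert, Finset.mem_image,
      Finset.mem_range, Nat.lt_succ_iff]
    grind
  by_cases hcross : ∃ d, 0 < d ∧ ∃ i, i + d ≤ p.length ∧
      G.Adj (p.getVert p.length) (p.getVert i) ∧ G.Adj (p.getVert 0) (p.getVert (i + d))
  · have hcard : ∀ u, (p.support.toFinset.filter (fun w => G.Adj u w)).card =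
        ((Finset.range (p.length + 1)).filter (fun j => G.Adj u (p.getVert j))).card := by
      intro u
      rw [hsupp, Finset.filter_image, Finset.card_image_of_injOn]
      intro i hi j hj h
      simp only [Finset.coe_filter, Finset.mem_range, Set.mem_ofPred_eq] at hi hj
      exact hinj i (by omega) j (by omega) h
    have := exists_isCycle_of_crossing hinj hadj hm hcross
    rwa [hv0, hvm, ← hcard, ← hcard, hl] at this
  have hmem : ∀ u, ∀ w ∈ p.support.toFinset.filter (fun w => G.Adj u w),
      G.Adj u w ∧ ∃ j ≤ p.length, p.getVert j = w := by
    intro u w hw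
    rw [hsupp, Finset.mem_filter, Finset.mem_image] at hw
    obtain ⟨⟨j, hj, rfl⟩, hu⟩ := hw
    exact ⟨hu, j, by simpa [Nat.lt_succ_iff] using hj, rfl⟩
  obtain ⟨s, hs, hsmax⟩ : ∃ s, (s ≤ p.length ∧ G.Adj (p.getVert 0) (p.getVert s)) ∧
      ∀ j ≤ p.length, G.Adj (p.getVert 0) (p.getVert j) → j ≤ s :=
    ⟨Nat.findGreatest (fun j => G.Adj (p.getVert 0) (p.getVert j)) p.length,
      ⟨Nat.findGreatest_le _, Nat.findGreatest_spec (m := 1)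
        (P := fun j => G.Adj (p.getVert 0) (p.getVert j)) (by omega) (hadj 0 (by omega))⟩,
      fun j hj h => Nat.le_findGreatest hj h⟩
  have hlast : G.Adj (p.getVert p.length) (p.getVert (p.length - 1)) := by
    have := hadj (p.length - 1) (by omega)
    rw [Nat.sub_add_cancel (by omega)] at this
    exact this.symm
  have hex : ∃ t, G.Adj (p.getVert p.length) (p.getVert t) := ⟨_, hlast⟩
  have hs1 := hsmax 1 (by omega) (hadj 0 (by omega))
  have ht1 := Nat.find_min' hex hlast
  have hst : s ≤ Nat.find hex := by
    by_contra hlt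
    refine hcross ⟨s - Nat.find hex, by omega, Nat.find hex, by omega, Nat.find_spec hex, ?_⟩
    rw [show Nat.find hex + (s - Nat.find hex) = s by omega]
    exact hs.2
  obtain ⟨z, c, hc, hlen⟩ := exists_isCycle_of_not_crossing hinj hadj hconn
    (by omega) hst (by omega) hs.2 (Nat.find_spec hex)
    (M := p.support.toFinset.filter (fun w => G.Adj x w))
    (N := p.support.toFinset.filter (fun w => G.Adj y w))
    (fun w hw => by
      obtain ⟨hxw, j, hj, rfl⟩ := hmem x w hw
      rw [hv0] at hsmax ⊢
      exact ⟨hxw, j, hsmax j hj hxw, rfl⟩)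
    (fun w hw => by
      obtain ⟨hyw, j, hj, rfl⟩ := hmem y w hw
      have hmj : G.Adj (p.getVert p.length) (p.getVert j) := by rwa [hvm]
      exact ⟨hmj, j, hj, Nat.find_min' hex hmj, rfl⟩)
  exact ⟨z, c, hc, (min_le_right _ _).trans hlen⟩
end

section
/- Let G be a graph on n ≥ 3 vertices with degree sequence d_1 ≤ d_2 ≤ ... ≤ d_n. If for every i < n/2, d_i ≤ i implies d_{n-i} ≥ n-i, then G is Hamiltonian. -/
namespace SimpleGraph

variable {V : Type*} [Fintype V] {G : SimpleGraph V} {u v : V}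

open Classical in
/-- Chvátal's condition, phrased through the numbers of vertices of small and large degree. -/
def ChvatalCondition (G : SimpleGraph V) : Prop :=
  ∀ i : ℕ, 1 ≤ i → 2 * i < Fintype.card V →
    i ≤ (Finset.univ.filter fun v ↦ G.degree v ≤ i).card →
      i < (Finset.univ.filter fun v ↦ Fintype.card V - i ≤ G.degree v).card

lemma ChvatalCondition.mono {H : SimpleGraph V} (hG : G.ChvatalCondition) (hle : G ≤ H) :
    H.ChvatalCondition := by
  classical
  intro i h1 h2 h3
  refine (hG i h1 h2 (h3.trans (Finset.card_le_card ?_))).trans_le (Finset.card_le_card ?_)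
  · exact Finset.monotone_filter_right _ fun v _ hv ↦ (degree_le_of_le hle).trans hv
  · exact Finset.monotone_filter_right _ fun v _ hv ↦ hv.trans (degree_le_of_le hle)

variable [DecidableEq V]

/-- Closing a Hamiltonian path whose endpoints are adjacent yields a Hamiltonian cycle. -/
lemma Walk.IsHamiltonian.isHamiltonian_of_adj {p : G.Walk u v} (hp : p.IsHamiltonian)
    (hV : 3 ≤ Fintype.card V) (h : G.Adj v u) : G.IsHamiltonian := by
  refine fun _ ↦ ⟨v, .cons h p, ?_⟩
  have hl := hp.length_eq
  rw [Walk.isHamiltonianCycle_iff_isCycle_and_length_eq, Walk.cons_isCycle_iff, Walk.length_cons]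
  refine ⟨⟨hp.isPath, fun he ↦ ?_⟩, by omega⟩
  have := hp.isPath.length_eq_one_of_mem_edges (Sym2.eq_swap ▸ he)
  omega

/-- A complete graph on at least three vertices is Hamiltonian. -/
lemma isHamiltonian_top (hV : 3 ≤ Fintype.card V) : (⊤ : SimpleGraph V).IsHamiltonian := by
  intro _
  have hc : (cycleGraph (Fintype.card V)).IsContained (⊤ : SimpleGraph V) :=
    isContained_top_iff.2 ⟨(Fintype.equivFin V).symm.toEmbedding⟩
  obtain ⟨a, p, hp, hl⟩ := (cycleGraph_isContained_iff hV).1 hc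
  exact ⟨a, p, Walk.isHamiltonianCycle_iff_isCycle_and_length_eq.2 ⟨hp, hl⟩⟩

/-- If adding the edge `uv` makes a non-Hamiltonian graph Hamiltonian, then the graph has a
Hamiltonian path from `u` to `v`. -/
lemma IsHamiltonian.exists_isHamiltonian_of_sup_edge (hV : 3 ≤ Fintype.card V)
    (hH : (G ⊔ edge u v).IsHamiltonian) (hG : ¬ G.IsHamiltonian) :
    ∃ p : G.Walk u v, p.IsHamiltonian := by
  have : Nontrivial V := Fintype.one_lt_card_iff_nontrivial.1 (by omega)
  have hsub : ∀ e ∈ (G ⊔ edge u v).edgeSet, e ≠ s(u, v) → e ∈ G.edgeSet := by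
    intro e he hne
    rw [edgeSet_sup] at he
    exact he.resolve_right fun h ↦ hne (edgeSet_edge_subset h)
  suffices ∃ p : (G ⊔ edge u v).Walk u v, p.IsHamiltonian by
    obtain ⟨p, hp⟩ := this
    have hl := hp.length_eq
    refine ⟨p.transfer G fun e he ↦ hsub e (p.edges_subset_edgeSet he) ?_, fun a ↦ ?_⟩
    · rintro rfl
      have := hp.isPath.length_eq_one_of_mem_edges he
      omega
    · simpa using hp a
  obtain ⟨c, hc⟩ := hH.exists_isHamiltonianCycle u
  have hmem : s(u, v) ∈ c.edges := by
    by_contra hmem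
    refine hG fun _ ↦ ⟨u, c.transfer G fun e he ↦ hsub e (c.edges_subset_edgeSet he) ?_, ?_⟩
    · rintro rfl
      exact hmem he
    · rw [Walk.isHamiltonianCycle_iff_isCycle_and_length_eq]
      exact ⟨hc.isCycle.transfer _, by simpa using hc.length_eq⟩
  cases c with
  | nil => simp at hmem
  | @cons _ x _ h q =>
    have hq : q.IsHamiltonian := by
      have := hc.isHamiltonian_tail
      intro a
      simpa using this a
    by_cases hx : x = v
    · subst hx
      exact ⟨q.reverse, fun a ↦ by simpa using hq a⟩
    · have hmem : s(u, v) ∈ q.edges := by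
        rw [Walk.edges_cons, List.mem_cons] at hmem
        refine hmem.resolve_left fun he ↦ hx ?_
        simpa using (Sym2.congr_right.1 he).symm
      have hv := hq.isPath.eq_penultimate_of_mem_edges hmem
      have hnil : ¬ q.Nil := by
        rw [Walk.not_nil_iff_lt_length, hq.length_eq]
        omega
      have hnodup := hq.isPath.support_nodup
      rw [← Walk.support_dropLast_concat hnil, List.nodup_append] at hnodup
      refine ⟨(Walk.cons h q.dropLast).copy rfl hv.symm, ?_⟩
      rw [Walk.isHamiltonian_iff_isPath_and_length_eq, Walk.isPath_copy, Walk.cons_isPath_iff]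
      refine ⟨⟨.mk' hnodup.1, fun hu ↦ hnodup.2.2 u hu u (by simp) rfl⟩, ?_⟩
      rw [Walk.not_nil_iff_lt_length] at hnil
      have := hq.length_eq
      simp only [Walk.length_copy, Walk.length_cons, Walk.length_dropLast]
      omega

/-- A Hamiltonian path from `u` to `v` with a crossing pair of chords at its endpoints can be
rerouted into a Hamiltonian cycle. -/
lemma Walk.IsHamiltonian.isHamiltonian_of_crossing {p : G.Walk u v} (hp : p.IsHamiltonian)
    (hV : 3 ≤ Fintype.card V) {k : ℕ} (hk : k < p.length) (hu : G.Adj u (p.getVert (k + 1)))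
    (hv : G.Adj v (p.getVert k)) : G.IsHamiltonian := by
  have hq : ((p.drop (k + 1)).append (.cons hv (p.take k).reverse)).IsHamiltonian := by
    intro a
    rw [Walk.support_append, Walk.drop_support_eq_support_drop_min,
      min_eq_left (Nat.succ_le_of_lt hk), Walk.support_cons, List.tail_cons,
      Walk.support_reverse, Walk.support_take, List.count_append, List.count_reverse, add_comm,
      ← List.count_append, List.take_append_drop]
    exact hp a
  exact hq.isHamiltonian_of_adj hV hu

/-- In a non-Hamiltonian graph, the predecessors of the neighbours of `u` along a Hamiltonian
path from `u` to `v` are distinct from `v` and not adjacent to `v`. -/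
lemma Walk.IsHamiltonian.exists_card_eq_degree {p : G.Walk u v} [DecidableRel G.Adj]
    (hp : p.IsHamiltonian) (hV : 3 ≤ Fintype.card V) (hG : ¬ G.IsHamiltonian) :
    ∃ P : Finset V, P.card = G.degree u ∧ ∀ w ∈ P, w ≠ v ∧ ¬ G.Adj v w := by
  let S := (Finset.range p.length).filter fun k ↦ G.Adj u (p.getVert (k + 1))
  have hinj := hp.isPath.getVert_injOn
  have hS : ∀ k ∈ S, k < p.length ∧ G.Adj u (p.getVert (k + 1)) := fun k hk ↦ by
    simpa [S] using hk
  refine ⟨S.image p.getVert, ?_, ?_⟩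
  · have himage : G.neighborFinset u = S.image fun k ↦ p.getVert (k + 1) := by
      ext w
      simp only [mem_neighborFinset, Finset.mem_image]
      constructor
      · intro hw
        obtain ⟨k, rfl, hk⟩ := Walk.mem_support_iff_exists_getVert.1 (hp.mem_support w)
        cases k with
        | zero => simp at hw
        | succ k => exact ⟨k, by simp [S, hw]; omega, rfl⟩
      · rintro ⟨k, hk, rfl⟩
        exact (hS k hk).2
    rw [← card_neighborFinset_eq_degree, himage, Finset.card_image_of_injOn,
      Finset.card_image_of_injOn]
    · intro a ha b hb hab
      have := hinj (show a + 1 ≤ _ from (hS a ha).1) (show b + 1 ≤ _ from (hS b hb).1) hab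
      omega
    · exact fun a ha b hb hab ↦ hinj (hS a ha).1.le (hS b hb).1.le hab
  · intro w hw
    obtain ⟨k, hk, rfl⟩ := Finset.mem_image.1 hw
    obtain ⟨hkl, hadj⟩ := hS k hk
    refine ⟨fun h ↦ ?_, fun h ↦ hG (hp.isHamiltonian_of_crossing hV hkl hadj h)⟩
    exact hkl.ne ((hp.isPath.getVert_eq_end_iff hkl.le).1 h)

/-- Among the non-adjacent pairs of a non-complete graph, some pair maximises the degree sum. -/
lemma exists_not_adj_degree_add_degree_max [DecidableRel G.Adj] (hG : G ≠ ⊤) :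
    ∃ u v, u ≠ v ∧ ¬ G.Adj u v ∧ G.degree u ≤ G.degree v ∧
      ∀ x y, x ≠ y → ¬ G.Adj x y → G.degree x + G.degree y ≤ G.degree u + G.degree v := by
  obtain ⟨a, b, hab, hnab⟩ := ne_top_iff_exists_not_adj.1 hG
  obtain ⟨⟨u, v⟩, huv, hmax⟩ := Finset.exists_max_image
    (Finset.univ.filter fun z : V × V ↦ z.1 ≠ z.2 ∧ ¬ G.Adj z.1 z.2)
    (fun z ↦ G.degree z.1 + G.degree z.2) ⟨(a, b), by simp [hab, hnab]⟩
  simp only [Finset.mem_filter, Finset.mem_univ, true_and, Prod.forall, and_imp] at huv hmax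
  rcases le_total (G.degree u) (G.degree v) with h | h
  · exact ⟨u, v, huv.1, huv.2, h, hmax⟩
  · exact ⟨v, u, huv.1.symm, fun h' ↦ huv.2 h'.symm, h,
      fun x y hx hy ↦ (hmax x y hx hy).trans_eq (add_comm _ _)⟩

/-- **Chvátal's theorem** for the counting form of the condition. -/
theorem ChvatalCondition.isHamiltonian (hG : G.ChvatalCondition) (hV : 3 ≤ Fintype.card V) :
    G.IsHamiltonian := by
  classical
  induction G using WellFoundedGT.induction with
  | ind G ih =>
  by_contra hnot
  obtain ⟨u, v, hne, hnadj, hle, hmax⟩ := exists_not_adj_degree_add_degree_max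
    fun h : G = ⊤ ↦ hnot (h ▸ isHamiltonian_top hV)
  obtain ⟨p, hp⟩ := (ih _ (lt_sup_edge _ _ _ hne hnadj)
    (hG.mono le_sup_left)).exists_isHamiltonian_of_sup_edge hV hnot
  obtain ⟨P, hcard, hP⟩ := hp.exists_card_eq_degree hV hnot
  have hpos : 1 ≤ G.degree u := by
    rw [Nat.one_le_iff_ne_zero, ← Nat.pos_iff_ne_zero, degree_pos_iff_exists_adj]
    exact ⟨_, p.adj_snd (Walk.not_nil_of_ne hne)⟩
  have hsum : G.degree u + G.degree v < Fintype.card V := by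
    have hdisj : Disjoint P (insert v (G.neighborFinset v)) := by
      rw [Finset.disjoint_left]
      intro w hw hw'
      have := hP w hw
      simp_all
    have := Finset.card_le_univ (P ∪ insert v (G.neighborFinset v))
    rw [Finset.card_union_of_disjoint hdisj, Finset.card_insert_of_notMem (by simp), hcard,
      card_neighborFinset_eq_degree] at this
    omega
  have hlarge := hG (G.degree u) hpos (by omega) (hcard ▸ Finset.card_le_card fun w hw ↦ by
    have := hmax w v (hP w hw).1 fun h ↦ (hP w hw).2 h.symm
    simp only [Finset.mem_filter, Finset.mem_univ, true_and]
    omega)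
  obtain ⟨w, hw, hwu⟩ := Finset.exists_mem_notMem_of_card_lt_card
    ((G.card_neighborFinset_eq_degree u).trans_lt hlarge)
  replace hw := (Finset.mem_filter.1 hw).2
  rw [mem_neighborFinset] at hwu
  have huw : u ≠ w := by
    rintro rfl
    omega
  have := hmax u w huw hwu
  omega

end SimpleGraph

/-- Chvátal: let `G` be a graph on `n ≥ 3` vertices with nondecreasing degree
sequence `d_1 ≤ … ≤ d_n` (given by an enumeration `e` of the vertices with
monotone degrees).  If for every `i` with `1 ≤ i < n/2`, `d_i ≤ i` implies
`d_{n-i} ≥ n-i`, then `G` is hamiltonian. -/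
theorem stmt_8 (n : ℕ) (hn : 3 ≤ n) (G : SimpleGraph (Fin n)) [DecidableRel G.Adj]
    (e : Fin n ≃ Fin n) (hmono : Monotone fun i => G.degree (e i))
    (hcond : ∀ i : ℕ, ∀ _h1 : 1 ≤ i, ∀ _h2 : 2 * i < n,
      G.degree (e ⟨i - 1, by omega⟩) ≤ i → n - i ≤ G.degree (e ⟨n - i - 1, by omega⟩)) :
    ∃ (v : Fin n) (c : G.Walk v v), c.IsHamiltonianCycle := by
  have hC : G.ChvatalCondition := by
    intro i h1 h2 h3
    rw [Fintype.card_fin] at h2 ⊢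
    have hsmall : G.degree (e ⟨i - 1, by omega⟩) ≤ i := by
      by_contra! hlt
      have hsub : (Finset.univ.filter fun v ↦ G.degree v ≤ i) ⊆
          (Finset.Iio (⟨i - 1, by omega⟩ : Fin n)).map e.toEmbedding := by
        intro v hv
        obtain ⟨j, rfl⟩ := e.surjective v
        refine Finset.mem_map.2 ⟨j, Finset.mem_Iio.2 ?_, rfl⟩
        by_contra! hge
        exact hlt.not_ge ((hmono hge).trans (Finset.mem_filter.1 hv).2)
      have := Finset.card_le_card hsub
      rw [Finset.card_map, Fin.card_Iio] at this
      simp only at this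
      have : i ≤ i - 1 := by
        refine le_trans (h3.trans_eq ?_) this
        congr!
      omega
    have hlarge := hcond i h1 h2 hsmall
    have hsub : (Finset.Ici (⟨n - i - 1, by omega⟩ : Fin n)).map e.toEmbedding ⊆
        Finset.univ.filter fun v ↦ n - i ≤ G.degree v := by
      intro v hv
      obtain ⟨j, hj, rfl⟩ := Finset.mem_map.1 hv
      exact Finset.mem_filter.2 ⟨Finset.mem_univ _, hlarge.trans (hmono (Finset.mem_Ici.1 hj))⟩
    have := Finset.card_le_card hsub
    rw [Finset.card_map, Fin.card_Ici] at this
    simp only at this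
    have h4 : i + 1 ≤ _ := le_trans (by omega) this
    refine h4.trans_eq ?_
    congr!
  exact hC.isHamiltonian (by simpa using hn) (by simp; omega)
end

section
/- Let s ≥ 4, i ∈ {1,2}, and let K be a subgraph of the complete bipartite graph K_{s,s} with at least s² - s + 2 + i edges. Then for every linear forest F in K with at most 2i edges and at most two components, K has a Hamiltonian cycle containing all edges of F. -/
/-- A linear forest: a graph all of whose components are paths, i.e. every
vertex has at most two neighbors and there are no cycles. -/
def IsLinearForest {V : Type*} (F : SimpleGraph V) : Prop :=
  (∀ v : V, (F.neighborSet v).ncard ≤ 2) ∧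
    ∀ (v : V) (w : F.Walk v v), ¬ w.IsCycle

open SimpleGraph

/-- Positions `t` and `u` are consecutive in the cyclic order on `0, …, n - 1`. -/
def CyclicAdj (n t u : ℕ) : Prop :=
  u = t + 1 ∨ t = u + 1 ∨ (t = 0 ∧ u + 1 = n) ∨ (u = 0 ∧ t + 1 = n)

/-- The sequence `v 0, …, v (n - 1)` runs injectively around a cycle of `K` whose edges include
every edge of `F` spanned by the sequence. -/
structure IsCycleSeq {V : Type*} (n : ℕ) (K F : SimpleGraph V) (v : ℕ → V) : Prop where
  inj : ∀ t u, t < n → u < n → v t = v u → t = u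
  adj : ∀ t u, t < n → u < n → CyclicAdj n t u → K.Adj (v t) (v u)
  cover : ∀ t u, t < n → u < n → F.Adj (v t) (v u) → CyclicAdj n t u

namespace IsCycleSeq

variable {V : Type*} {n : ℕ} {K F : SimpleGraph V} {v : ℕ → V}

theorem of_lt (inj : ∀ t u, t < n → u < n → v t = v u → t = u)
    (step : ∀ t, t + 1 < n → K.Adj (v t) (v (t + 1))) (close : K.Adj (v 0) (v (n - 1)))
    (cover : ∀ t u, t < u → u < n → F.Adj (v t) (v u) → u = t + 1 ∨ (t = 0 ∧ u + 1 = n)) :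
    IsCycleSeq n K F v where
  inj := inj
  adj t u ht hu h := by
    rcases h with rfl | rfl | ⟨rfl, h⟩ | ⟨rfl, h⟩
    · exact step _ hu
    · exact (step _ ht).symm
    · obtain rfl : u = n - 1 := by lia
      exact close
    · obtain rfl : t = n - 1 := by lia
      exact close.symm
  cover t u ht hu h := by
    rcases lt_trichotomy t u with h' | rfl | h'
    · have := cover t u h' hu h
      unfold CyclicAdj; lia
    · exact (F.loopless.irrefl _ h).elim
    · have := cover u t h' ht h.symm
      unfold CyclicAdj; lia

theorem reindex (h : IsCycleSeq n K F v) (f : ℕ → ℕ) (hlt : ∀ k, k < n → f k < n)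
    (hinj : ∀ k l, k < n → l < n → f k = f l → k = l)
    (hadj : ∀ k l, k < n → l < n → (CyclicAdj n k l ↔ CyclicAdj n (f k) (f l))) :
    IsCycleSeq n K F (v ∘ f) where
  inj k l hk hl e := hinj k l hk hl (h.inj _ _ (hlt k hk) (hlt l hl) e)
  adj k l hk hl e := h.adj _ _ (hlt k hk) (hlt l hl) ((hadj k l hk hl).1 e)
  cover k l hk hl e := (hadj k l hk hl).2 (h.cover _ _ (hlt k hk) (hlt l hl) e)

/-- A cyclic sequence can be rotated, and reversed if needed, so that a given pair of consecutive
positions becomes the first and the last one. -/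
theorem exists_rotate (h : IsCycleSeq n K F v) {t u : ℕ} (ht : t < n) (hu : u < n)
    (htu : CyclicAdj n t u) :
    ∃ w, IsCycleSeq n K F w ∧ w 0 = v t ∧ w (n - 1) = v u := by
  by_cases hsucc : u = t + 1 ∨ (u = 0 ∧ t + 1 = n)
  · refine ⟨_, h.reindex (fun k => if k ≤ t then t - k else n + t - k) ?_ ?_ ?_, ?_, ?_⟩
    · intro k hk; split_ifs <;> lia
    · intro k l hk hl; split_ifs <;> lia
    · intro k l hk hl; unfold CyclicAdj; split_ifs <;> lia
    · simp
    · simp only [Function.comp]; congr 1; split_ifs <;> lia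
  · have hpred : t = u + 1 ∨ (t = 0 ∧ u + 1 = n) := by unfold CyclicAdj at htu; lia
    refine ⟨_, h.reindex (fun k => if t + k < n then t + k else t + k - n) ?_ ?_ ?_, ?_, ?_⟩
    · intro k hk; split_ifs <;> lia
    · intro k l hk hl; split_ifs <;> lia
    · intro k l hk hl; unfold CyclicAdj; split_ifs <;> lia
    · simp [ht]
    · simp only [Function.comp]; congr 1; split_ifs <;> lia

/-- Reversing the initial segment `v 0, …, v j` of a spanning path closes it into a cycle. -/
theorem reverse_prefix (inj : ∀ t u, t < n → u < n → v t = v u → t = u) {j : ℕ} (hj : j + 1 < n)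
    (step : ∀ t, t + 1 < n → t ≠ j → K.Adj (v t) (v (t + 1)))
    (hjoin : K.Adj (v 0) (v (j + 1))) (hclose : K.Adj (v j) (v (n - 1)))
    (cover : ∀ t u, t < u → u < n → F.Adj (v t) (v u) →
      (u = t + 1 ∧ t ≠ j) ∨ (t = j ∧ u + 1 = n)) :
    IsCycleSeq n K F fun k => v (if k ≤ j then j - k else k) := by
  apply of_lt
  · intro t u ht hu e
    have := inj _ _ (by split_ifs <;> lia) (by split_ifs <;> lia) e
    split_ifs at this <;> lia
  · intro t ht
    rcases lt_trichotomy t j with h | rfl | h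
    · rw [if_pos (by lia), if_pos (by lia)]
      have := step (j - (t + 1)) (by lia) (by lia)
      rw [show j - (t + 1) + 1 = j - t by lia] at this
      exact this.symm
    · simpa using hjoin
    · rw [if_neg (by lia), if_neg (by lia)]
      exact step t ht (by lia)
  · rw [if_pos (by lia), if_neg (by lia)]
    simpa using hclose
  · intro t u htu hu h
    have h1 := fun a b => cover _ _ a b h
    have h2 := fun a b => cover _ _ a b h.symm
    split_ifs at h1 h2 <;> lia

/-- Moving the pair `v q, v (q + 1)` of a spanning path to its end closes it into a cycle. -/
theorem move_pair (inj : ∀ t u, t < n → u < n → v t = v u → t = u) {q : ℕ} (hq : 0 < q)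
    (hqn : q + 2 < n) (step : ∀ t, t + 1 < n → K.Adj (v t) (v (t + 1)))
    (hjoin : K.Adj (v (q - 1)) (v (q + 2))) (hlast : K.Adj (v (n - 1)) (v q))
    (hclose : K.Adj (v 0) (v (q + 1)))
    (cover : ∀ t u, t < u → u < n → F.Adj (v t) (v u) →
      u = t + 1 ∧ t ≠ q - 1 ∧ t ≠ q + 1) :
    IsCycleSeq n K F fun k =>
      v (if k < q then k else if k + 2 < n then k + 2 else k + 2 - n + q) := by
  apply of_lt
  · intro t u ht hu e
    have := inj _ _ (by split_ifs <;> lia) (by split_ifs <;> lia) e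
    split_ifs at this <;> lia
  · intro t ht
    have key (a b : ℕ) (h : (b = a + 1 ∧ a + 1 < n) ∨ (a = q - 1 ∧ b = q + 2) ∨
        (a = n - 1 ∧ b = q)) : K.Adj (v a) (v b) := by
      rcases h with ⟨rfl, h⟩ | ⟨rfl, rfl⟩ | ⟨rfl, rfl⟩
      exacts [step _ h, hjoin, hlast]
    apply key
    split_ifs <;> lia
  · rw [if_pos hq, if_neg (by lia), if_neg (by lia)]
    rwa [show n - 1 + 2 - n + q = q + 1 by lia]
  · intro t u htu hu h
    have h1 := fun a b => cover _ _ a b h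
    have h2 := fun a b => cover _ _ a b h.symm
    split_ifs at h1 h2 <;> lia

theorem exists_eq [Fintype V] (hn : Fintype.card V = n)
    (inj : ∀ t u, t < n → u < n → v t = v u → t = u) (x : V) : ∃ t < n, v t = x := by
  have hb : Function.Bijective fun t : Fin n => v t :=
    (Fintype.bijective_iff_injective_and_card _).2
      ⟨fun t u e => Fin.ext (inj _ _ t.2 u.2 e), by simp [hn]⟩
  obtain ⟨t, ht⟩ := hb.2 x
  exact ⟨t, t.2, ht⟩

theorem exists_walk (step : ∀ t, t + 1 < n → K.Adj (v t) (v (t + 1))) (k : ℕ) (hk : k < n) :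
    ∃ p : K.Walk (v 0) (v k), p.support = (List.range (k + 1)).map v ∧
      ∀ t, t < k → s(v t, v (t + 1)) ∈ p.edges := by
  induction k with
  | zero => exact ⟨.nil, by simp⟩
  | succ k ih =>
    obtain ⟨p, hp, he⟩ := ih (by lia)
    refine ⟨p.concat (step k hk), ?_, ?_⟩
    · rw [Walk.support_concat, hp, List.range_succ (n := k + 1)]
      simp
    · intro t ht
      rw [Walk.edges_concat]
      rcases Nat.lt_succ_iff_lt_or_eq.1 ht with h | rfl
      · simp [he t h]
      · simp

theorem exists_isHamiltonianCycle [Fintype V] [DecidableEq V] (hn : Fintype.card V = n)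
    (h3 : 3 ≤ n) (h : IsCycleSeq n K F v) :
    ∃ (x : V) (c : K.Walk x x), c.IsHamiltonianCycle ∧ ∀ e ∈ F.edgeSet, e ∈ c.edges := by
  have step (t) (ht : t + 1 < n) : K.Adj (v t) (v (t + 1)) :=
    h.adj _ _ (by lia) ht (by simp [CyclicAdj])
  obtain ⟨p, hp, he⟩ := exists_walk step (n - 1) (by lia)
  rw [Nat.sub_add_cancel (by lia)] at hp
  have close : K.Adj (v (n - 1)) (v 0) :=
    h.adj _ _ (by lia) (by lia) (by unfold CyclicAdj; lia)
  have hpath : p.IsPath := by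
    rw [Walk.isPath_def, hp]
    refine List.Nodup.map_on ?_ List.nodup_range
    intro t ht u hu e
    exact h.inj _ _ (List.mem_range.1 ht) (List.mem_range.1 hu) e
  have hlen : p.length = n - 1 := by
    have := congrArg List.length hp
    simp at this; lia
  refine ⟨v (n - 1), .cons close p, ⟨?_, ?_⟩, ?_⟩
  · rw [Walk.cons_isCycle_iff]
    refine ⟨hpath, fun hmem => ?_⟩
    have := hpath.length_eq_one_of_mem_edges (Sym2.eq_swap ▸ hmem)
    lia
  · have : p.IsHamiltonian := hpath.isHamiltonian_of_mem fun x => by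
      obtain ⟨t, ht, rfl⟩ := exists_eq hn h.inj x
      rw [hp]
      exact List.mem_map_of_mem (List.mem_range.2 ht)
    simpa [Walk.IsHamiltonian] using this
  · intro e
    induction e with | _ x y
    intro hxy
    obtain ⟨t, ht, rfl⟩ := exists_eq hn h.inj x
    obtain ⟨u, hu, rfl⟩ := exists_eq hn h.inj y
    rw [Walk.edges_cons, List.mem_cons]
    rcases h.cover _ _ ht hu hxy with rfl | rfl | ⟨rfl, h'⟩ | ⟨rfl, h'⟩
    · exact .inr (he _ (by lia))
    · rw [Sym2.eq_swap]; exact .inr (he _ (by lia))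
    · obtain rfl : u = n - 1 := by lia
      exact .inl Sym2.eq_swap
    · obtain rfl : t = n - 1 := by lia
      exact .inl rfl

end IsCycleSeq

section Bipartite

variable {s : ℕ}

theorem completeBipartiteGraph_adj_iff {x y : Fin s ⊕ Fin s} :
    (completeBipartiteGraph (Fin s) (Fin s)).Adj x y ↔ x.isLeft ≠ y.isLeft := by
  cases x <;> cases y <;> simp

theorem adj_iff_mod_two_ne_of_step {n : ℕ} {v : ℕ → Fin s ⊕ Fin s}
    (step : ∀ t, t + 1 < n → (completeBipartiteGraph (Fin s) (Fin s)).Adj (v t) (v (t + 1)))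
    {t u : ℕ} (ht : t < n) (hu : u < n) :
    (completeBipartiteGraph (Fin s) (Fin s)).Adj (v t) (v u) ↔ t % 2 ≠ u % 2 := by
  have side (t) (ht : t < n) : (v t).isLeft = (v 0).isLeft ↔ t % 2 = 0 := by
    induction t with
    | zero => simp
    | succ t ih =>
      have h1 := ih (by lia)
      have h2 := completeBipartiteGraph_adj_iff.1 (step t ht)
      generalize (v t).isLeft = x, (v (t + 1)).isLeft = y, (v 0).isLeft = z at h1 h2 ⊢
      cases x <;> cases y <;> cases z <;> simp at h1 h2 ⊢ <;> lia
  have h1 := side t ht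
  have h2 := side u hu
  rw [completeBipartiteGraph_adj_iff]
  generalize (v t).isLeft = x, (v u).isLeft = y, (v 0).isLeft = z at h1 h2 ⊢
  cases x <;> cases y <;> cases z <;> simp at h1 h2 ⊢ <;> lia

theorem exists_isCycleSeq_bot (hs : 2 ≤ s) :
    ∃ v, IsCycleSeq (2 * s) (completeBipartiteGraph (Fin s) (Fin s)) ⊥ v := by
  have hpos : 0 < s := by lia
  refine ⟨fun t => if t % 2 = 0 then .inl ⟨t / 2 % s, Nat.mod_lt _ hpos⟩
    else .inr ⟨t / 2 % s, Nat.mod_lt _ hpos⟩, .of_lt ?_ ?_ ?_ ?_⟩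
  · intro t u ht hu e
    have h1 : t / 2 % s = t / 2 := Nat.mod_eq_of_lt (by lia)
    have h2 : u / 2 % s = u / 2 := Nat.mod_eq_of_lt (by lia)
    simp only [h1, h2] at e
    split_ifs at e <;> simp at e <;> lia
  · intro t ht
    rw [completeBipartiteGraph_adj_iff]
    split_ifs <;> first | lia | simp
  · rw [completeBipartiteGraph_adj_iff]
    split_ifs <;> first | lia | simp
  · simp

theorem SimpleGraph.IsAcyclic.exists_adj_unique {V : Type*} [Finite V] {F : SimpleGraph V}
    (hF : F.IsAcyclic) {x y : V} (hxy : F.Adj x y) : ∃ a b, F.Adj a b ∧ ∀ c, F.Adj a c → c = b := by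
  have : Nonempty V := ⟨x⟩
  obtain ⟨u, v, p, hp, hmax⟩ := Walk.exists_isPath_forall_isPath_length_le_length F
  have hlen : 1 ≤ p.length := by
    simpa using hmax _ _ (Walk.cons hxy .nil) (by simp [hxy.ne])
  have hnil : ¬ p.Nil := by rw [← Walk.length_eq_zero_iff]; lia
  refine ⟨u, p.snd, p.adj_snd hnil, fun c hc => hF.eq_snd_of_adj_start hp hc ?_⟩
  by_contra hsupp
  have := hmax _ _ (p.cons hc.symm) (hp.cons hsupp)
  simp at this

/-- Every linear forest of the complete bipartite graph lies in a Hamiltonian cycle. -/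
theorem exists_isCycleSeq_completeBipartiteGraph (hs : 2 ≤ s) (F : SimpleGraph (Fin s ⊕ Fin s))
    (hle : F ≤ completeBipartiteGraph (Fin s) (Fin s)) (hdeg : ∀ v, (F.neighborSet v).ncard ≤ 2)
    (hac : F.IsAcyclic) :
    ∃ v, IsCycleSeq (2 * s) (completeBipartiteGraph (Fin s) (Fin s)) F v := by
  induction hk : F.edgeSet.ncard using Nat.strong_induction_on generalizing F with
  | _ k ih
  subst hk
  rcases eq_or_ne F ⊥ with rfl | hne
  · exact exists_isCycleSeq_bot hs
  obtain ⟨x, y, hxy⟩ := ne_bot_iff_exists_adj.1 hne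
  obtain ⟨a, b, hab, huniq⟩ := hac.exists_adj_unique hxy
  have hsub : F.deleteEdges {s(a, b)} ≤ F := deleteEdges_le _
  have hnbr (z) : (F.deleteEdges {s(a, b)}).neighborSet z ⊆ F.neighborSet z := fun _ h => hsub h
  obtain ⟨v, hv⟩ := ih _ (Set.ncard_lt_ncard (by
      rw [edgeSet_deleteEdges]
      exact Set.sdiff_singleton_ssubset.2 hab)) (F.deleteEdges {s(a, b)})
    (hsub.trans hle) (fun z => (Set.ncard_le_ncard (hnbr z)).trans (hdeg z)) (hac.anti hsub) rfl
  have hcard : Fintype.card (Fin s ⊕ Fin s) = 2 * s := by simp; lia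
  obtain ⟨u, hu, rfl⟩ := IsCycleSeq.exists_eq hcard hv.inj b
  obtain ⟨u', hu', huu', hnot⟩ : ∃ u' < 2 * s, CyclicAdj (2 * s) u' u ∧
      ¬ (F.deleteEdges {s(a, v u)}).Adj (v u) (v u') := by
    by_contra! hcon
    obtain ⟨p, q, hp, hq, hpq, hpu, hqu⟩ : ∃ p q, p < 2 * s ∧ q < 2 * s ∧ p ≠ q ∧
        CyclicAdj (2 * s) p u ∧ CyclicAdj (2 * s) q u := by
      refine ⟨if u = 0 then 2 * s - 1 else u - 1, if u + 1 = 2 * s then 0 else u + 1, ?_⟩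
      unfold CyclicAdj
      split_ifs <;> lia
    have h1 := hcon p hp hpu
    have h2 := hcon q hq hqu
    rw [deleteEdges_adj] at h1 h2
    have hpa : v p ≠ a := by rintro rfl; simp [Sym2.eq_swap] at h1
    have hqa : v q ≠ a := by rintro rfl; simp [Sym2.eq_swap] at h2
    have hpq' : v p ≠ v q := fun e => hpq (hv.inj _ _ hp hq e)
    have h3 : ({v p, v q, a} : Set (Fin s ⊕ Fin s)).ncard = 3 :=
      Set.ncard_eq_three.2 ⟨_, _, _, hpq', hpa, hqa, rfl⟩
    have h4 : ({v p, v q, a} : Set (Fin s ⊕ Fin s)) ⊆ F.neighborSet (v u) := by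
      rintro z (rfl | rfl | rfl)
      exacts [h1.1, h2.1, hab.symm]
    have := Set.ncard_le_ncard h4
    have := hdeg (v u)
    lia
  obtain ⟨w, hw, hw0, hwn⟩ := hv.exists_rotate hu' hu huu'
  rw [← hwn] at hab huniq hw
  rw [← hwn, ← hw0] at hnot
  obtain ⟨j, hj, rfl⟩ := IsCycleSeq.exists_eq hcard hw.inj a
  have hjn : j ≠ 2 * s - 1 := by rintro rfl; exact hab.ne rfl
  have step (t) (ht : t + 1 < 2 * s) := hw.adj t (t + 1) (by lia) ht (.inl rfl)
  have side {t u : ℕ} := adj_iff_mod_two_ne_of_step step (t := t) (u := u)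
  have hjeven := (side hj (by lia)).1 (hle hab)
  refine ⟨_, IsCycleSeq.reverse_prefix (j := j) hw.inj (by lia) (fun t ht _ => step t ht)
    ((side (by lia) (by lia)).2 (by lia)) (hle hab) ?_⟩
  · intro t u htu hu h
    by_cases htj : t = j
    · subst htj
      have := hw.inj _ _ hu (by lia) (huniq _ h)
      lia
    have huj : u ≠ j := by
      rintro rfl
      have := hw.inj _ _ (by lia) (by lia) (huniq _ h.symm)
      lia
    have h' : (F.deleteEdges {s(w j, w (2 * s - 1))}).Adj (w t) (w u) := by
      rw [deleteEdges_adj]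
      refine ⟨h, ?_⟩
      intro hmem
      rcases Sym2.eq_iff.1 (Set.mem_singleton_iff.1 hmem) with ⟨e, -⟩ | ⟨-, e⟩
      · exact htj (hw.inj _ _ (by lia) hj e)
      · exact huj (hw.inj _ _ hu hj e)
    rcases hw.cover _ _ (by lia) hu h' with h1 | h1 | ⟨rfl, h1⟩ | h1
    · exact .inl ⟨h1, htj⟩
    · lia
    · obtain rfl : u = 2 * s - 1 := by lia
      exact (hnot h'.symm).elim
    · lia


/-- A spanning path of `K` through all edges of `F` can be turned into a spanning cycle of `K`
through all edges of `F` when `K` misses few edges and `F` has few edges and no large matching. -/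
theorem exists_isCycleSeq_of_path {i : ℕ} (hi : i ≤ 2) {K F : SimpleGraph (Fin s ⊕ Fin s)}
    (hK : K ≤ completeBipartiteGraph (Fin s) (Fin s))
    (hmiss : (completeBipartiteGraph (Fin s) (Fin s) \ K).edgeSet.ncard + i + 2 ≤ s)
    (hFe : F.edgeSet.ncard ≤ 2 * i)
    {w : ℕ → Fin s ⊕ Fin s} (inj : ∀ t u, t < 2 * s → u < 2 * s → w t = w u → t = u)
    (hmatch : ∀ O : Finset ℕ,
      (∀ j ∈ O, j < s ∧ F.Adj (w (2 * j)) (w (2 * j + 1))) → O.card ≤ i + 1)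
    (step : ∀ t, t + 1 < 2 * s → K.Adj (w t) (w (t + 1)))
    (hends : ¬ K.Adj (w 0) (w (2 * s - 1)))
    (cover : ∀ t u, t < u → u < 2 * s → F.Adj (w t) (w u) → u = t + 1) :
    ∃ v, IsCycleSeq (2 * s) K F v := by
  classical
  by_contra hcon
  have side {t u : ℕ} := adj_iff_mod_two_ne_of_step (fun t ht => hK (step t ht)) (t := t) (u := u)
  have edge_eq {a b c d : ℕ} (ha : a < 2 * s) (hb : b < 2 * s) (hc : c < 2 * s) (hd : d < 2 * s)
      (e : s(w a, w b) = s(w c, w d)) : (a = c ∧ b = d) ∨ (a = d ∧ b = c) := by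
    rcases Sym2.eq_iff.1 e with ⟨e1, e2⟩ | ⟨e1, e2⟩
    · exact .inl ⟨inj _ _ ha hc e1, inj _ _ hb hd e2⟩
    · exact .inr ⟨inj _ _ ha hd e1, inj _ _ hb hc e2⟩
  set M := (completeBipartiteGraph (Fin s) (Fin s) \ K).edgeSet.toFinset with hM
  have hMcard : M.card = (completeBipartiteGraph (Fin s) (Fin s) \ K).edgeSet.ncard :=
    (Set.ncard_eq_toFinset_card' _).symm
  have mem_M {t u : ℕ} (ht : t < 2 * s) (hu : u < 2 * s) (h : t % 2 ≠ u % 2)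
      (hn : ¬ K.Adj (w t) (w u)) : s(w t, w u) ∈ M := by
    simp only [hM, Set.mem_toFinset, mem_edgeSet, sdiff_adj]
    exact ⟨(side ht hu).2 h, hn⟩
  set J := (Finset.range s).filter fun j =>
    K.Adj (w 0) (w (2 * j + 1)) ∧ K.Adj (w (2 * j)) (w (2 * s - 1)) with hJ
  set A := (Finset.range s).filter fun j => ¬ K.Adj (w 0) (w (2 * j + 1)) with hA
  set B := (Finset.range s).filter fun j => 0 < j ∧ ¬ K.Adj (w (2 * j)) (w (2 * s - 1)) with hB
  set O := (Finset.range s).filter fun j => F.Adj (w (2 * j)) (w (2 * j + 1)) with hO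
  set D := (Finset.range (s - 1)).filter fun j =>
    F.Adj (w (2 * j + 1)) (w (2 * j + 2)) with hD
  set U := A.image (fun j => s(w 0, w (2 * j + 1))) ∪
    B.image (fun j => s(w (2 * j), w (2 * s - 1))) with hU
  have hUcard : U.card = A.card + B.card := by
    rw [hU, Finset.card_union_of_disjoint, Finset.card_image_of_injOn, Finset.card_image_of_injOn]
    · intro j hj k hk e
      simp only [hB, Finset.coe_filter, Finset.mem_range, Set.mem_ofPred_eq] at hj hk
      have := edge_eq (by lia) (by lia) (by lia) (by lia) e
      lia
    · intro j hj k hk e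
      simp only [hA, Finset.coe_filter, Finset.mem_range, Set.mem_ofPred_eq] at hj hk
      have := edge_eq (by lia) (by lia) (by lia) (by lia) e
      lia
    · rw [Finset.disjoint_left]
      simp only [Finset.mem_image, not_exists, not_and]
      rintro _ ⟨j, hj, rfl⟩ k hk e
      simp only [hA, hB, Finset.mem_filter, Finset.mem_range] at hj hk
      have := edge_eq (by lia) (by lia) (by lia) (by lia) e
      lia
  have hUM : U ⊆ M := by
    intro e he
    rw [hU, Finset.mem_union, Finset.mem_image, Finset.mem_image] at he
    rcases he with ⟨j, hj, rfl⟩ | ⟨j, hj, rfl⟩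
    · rw [hA, Finset.mem_filter, Finset.mem_range] at hj
      exact mem_M (by lia) (by lia) (by lia) hj.2
    · rw [hB, Finset.mem_filter, Finset.mem_range] at hj
      exact mem_M (by lia) (by lia) (by lia) hj.2.2
  have hUle := Finset.card_le_card hUM
  have hJcard : s ≤ J.card + (A.card + B.card + 1) := by
    have hsub : Finset.range s ⊆ J ∪ (A ∪ B ∪ {0}) := by
      intro j hj
      simp only [hJ, hA, hB, Finset.mem_union, Finset.mem_filter, Finset.mem_singleton, hj,
        true_and, Nat.pos_iff_ne_zero]
      tauto
    have h1 := Finset.card_le_card hsub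
    have h2 := Finset.card_union_le J (A ∪ B ∪ {0})
    have h3 := Finset.card_union_le (A ∪ B) {0}
    have h4 := Finset.card_union_le A B
    simp only [Finset.card_range, Finset.card_singleton] at *
    lia
  have hJO : J ⊆ O := by
    intro j hj
    rw [hJ, Finset.mem_filter, Finset.mem_range] at hj
    rw [hO, Finset.mem_filter, Finset.mem_range]
    refine ⟨hj.1, ?_⟩
    by_contra hF
    refine hcon ⟨_, IsCycleSeq.reverse_prefix (j := 2 * j) inj (by lia) (fun t ht _ => step t ht)
      hj.2.1 hj.2.2 fun t u htu hu h => .inl ?_⟩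
    obtain rfl := cover t u htu hu h
    refine ⟨rfl, ?_⟩
    rintro rfl
    exact hF h
  have hOcard : O.card ≤ i + 1 := hmatch O fun j hj => by
    rwa [hO, Finset.mem_filter, Finset.mem_range] at hj
  have hODcard : O.card + D.card ≤ 2 * i := by
    refine le_trans ?_ hFe
    rw [Set.ncard_eq_toFinset_card']
    have hsub : O.image (fun j => s(w (2 * j), w (2 * j + 1))) ∪
        D.image (fun j => s(w (2 * j + 1), w (2 * j + 2))) ⊆ F.edgeSet.toFinset := by
      intro e he
      rw [Finset.mem_union, Finset.mem_image, Finset.mem_image] at he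
      rcases he with ⟨j, hj, rfl⟩ | ⟨j, hj, rfl⟩
      · simpa using (Finset.mem_filter.1 hj).2
      · simpa using (Finset.mem_filter.1 hj).2
    refine le_trans (le_of_eq ?_) (Finset.card_le_card hsub)
    rw [Finset.card_union_of_disjoint, Finset.card_image_of_injOn, Finset.card_image_of_injOn]
    · intro j hj k hk e
      simp only [hD, Finset.coe_filter, Finset.mem_range, Set.mem_ofPred_eq] at hj hk
      have := edge_eq (by lia) (by lia) (by lia) (by lia) e
      lia
    · intro j hj k hk e
      simp only [hO, Finset.coe_filter, Finset.mem_range, Set.mem_ofPred_eq] at hj hk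
      have := edge_eq (by lia) (by lia) (by lia) (by lia) e
      lia
    · rw [Finset.disjoint_left]
      simp only [Finset.mem_image, not_exists, not_and]
      rintro _ ⟨j, hj, rfl⟩ k hk e
      simp only [hO, hD, Finset.mem_filter, Finset.mem_range] at hj hk
      have := edge_eq (by lia) (by lia) (by lia) (by lia) e
      lia
  have hJOcard := Finset.card_le_card hJO
  have hUeq : U = M := Finset.eq_of_subset_of_card_le hUM (by lia)
  obtain ⟨j, hjJ, hjD⟩ : ∃ j ∈ J, j ∉ D ∪ D.image (· + 1) := by
    by_contra! hsub
    have h1 := Finset.card_le_card hsub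
    have h2 := Finset.card_union_le D (D.image (· + 1))
    have h3 : (D.image (· + 1)).card ≤ D.card := Finset.card_image_le
    lia
  rw [hJ, Finset.mem_filter, Finset.mem_range] at hjJ
  obtain ⟨hjs, hj0, hjn⟩ := hjJ
  have hjpos : 0 < j := by
    rcases Nat.eq_zero_or_pos j with rfl | h
    · exact (hends hjn).elim
    · exact h
  have hjlast : j + 1 < s := by
    by_contra h
    rw [show 2 * j + 1 = 2 * s - 1 by lia] at hj0
    exact hends hj0
  refine hcon ⟨_, IsCycleSeq.move_pair (q := 2 * j) inj (by lia) (by lia) step ?_ hjn.symm hj0 ?_⟩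
  · by_contra hnadj
    have hmem := mem_M (by lia) (by lia) (by lia) hnadj
    rw [← hUeq, hU, Finset.mem_union, Finset.mem_image, Finset.mem_image] at hmem
    rcases hmem with ⟨k, hk, e⟩ | ⟨k, hk, e⟩
    · rw [hA, Finset.mem_filter, Finset.mem_range] at hk
      have := edge_eq (by lia) (by lia) (by lia) (by lia) e
      lia
    · rw [hB, Finset.mem_filter, Finset.mem_range] at hk
      have := edge_eq (by lia) (by lia) (by lia) (by lia) e
      lia
  · intro t u htu hu h
    obtain rfl := cover t u htu hu h
    refine ⟨rfl, ?_, ?_⟩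
    · rintro rfl
      apply hjD
      rw [Finset.mem_union, Finset.mem_image]
      refine .inr ⟨j - 1, ?_, by lia⟩
      rw [hD, Finset.mem_filter, Finset.mem_range]
      refine ⟨by lia, ?_⟩
      convert h using 2 <;> lia
    · rintro rfl
      apply hjD
      rw [Finset.mem_union]
      refine .inl ?_
      rw [hD, Finset.mem_filter, Finset.mem_range]
      exact ⟨by lia, h⟩

theorem exists_isCycleSeq_of_sup_edge {i : ℕ} (hi : i ≤ 2) {K F : SimpleGraph (Fin s ⊕ Fin s)}
    (hK : K ≤ completeBipartiteGraph (Fin s) (Fin s)) (hFK : F ≤ K)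
    (hmiss : (completeBipartiteGraph (Fin s) (Fin s) \ K).edgeSet.ncard + i + 2 ≤ s)
    (hFe : F.edgeSet.ncard ≤ 2 * i)
    (hmatch : ∀ w : ℕ → Fin s ⊕ Fin s, (∀ t u, t < 2 * s → u < 2 * s → w t = w u → t = u) →
      ∀ O : Finset ℕ, (∀ j ∈ O, j < s ∧ F.Adj (w (2 * j)) (w (2 * j + 1))) → O.card ≤ i + 1)
    {x y : Fin s ⊕ Fin s} (hxy : ¬ K.Adj x y) {v : ℕ → Fin s ⊕ Fin s}
    (hv : IsCycleSeq (2 * s) (K ⊔ edge x y) F v) :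
    ∃ v, IsCycleSeq (2 * s) K F v := by
  by_cases hused : ∃ t u, t < 2 * s ∧ u < 2 * s ∧ CyclicAdj (2 * s) t u ∧ v t = x ∧ v u = y
  · obtain ⟨t, u, ht, hu, htu, rfl, rfl⟩ := hused
    obtain ⟨w, hw, hw0, hwn⟩ := hv.exists_rotate ht hu htu
    rw [← hw0, ← hwn] at hxy hw
    refine exists_isCycleSeq_of_path hi hK hmiss hFe hw.inj (hmatch w hw.inj) ?_ hxy ?_
    · intro t ht
      rcases hw.adj t (t + 1) (by lia) ht (.inl rfl) with h | h
      · exact h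
      · rw [edge_adj] at h
        rcases h.1 with ⟨e1, e2⟩ | ⟨e1, e2⟩
        · have := hw.inj _ _ (by lia) (by lia) e1
          have := hw.inj _ _ (by lia) (by lia) e2
          lia
        · have := hw.inj _ _ (by lia) (by lia) e1
          lia
    · intro t u htu hu h
      rcases hw.cover t u (by lia) hu h with h1 | h1 | ⟨rfl, h1⟩ | h1
      · exact h1
      · lia
      · obtain rfl : u = 2 * s - 1 := by lia
        exact (hxy (hFK h)).elim
      · lia
  · refine ⟨v, hv.inj, fun t u ht hu htu => ?_, hv.cover⟩
    rcases hv.adj t u ht hu htu with h | h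
    · exact h
    · rw [edge_adj] at h
      rcases h.1 with ⟨e1, e2⟩ | ⟨e1, e2⟩
      · exact (hused ⟨t, u, ht, hu, htu, e1, e2⟩).elim
      · exact (hused ⟨u, t, hu, ht, by unfold CyclicAdj at *; lia, e2, e1⟩).elim

theorem exists_isCycleSeq (hs : 2 ≤ s) {i : ℕ} (hi : i ≤ 2) {K F : SimpleGraph (Fin s ⊕ Fin s)}
    (hK : K ≤ completeBipartiteGraph (Fin s) (Fin s)) (hFK : F ≤ K)
    (hmiss : (completeBipartiteGraph (Fin s) (Fin s) \ K).edgeSet.ncard + i + 2 ≤ s)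
    (hdeg : ∀ v, (F.neighborSet v).ncard ≤ 2) (hac : F.IsAcyclic)
    (hFe : F.edgeSet.ncard ≤ 2 * i)
    (hmatch : ∀ w : ℕ → Fin s ⊕ Fin s, (∀ t u, t < 2 * s → u < 2 * s → w t = w u → t = u) →
      ∀ O : Finset ℕ, (∀ j ∈ O, j < s ∧ F.Adj (w (2 * j)) (w (2 * j + 1))) → O.card ≤ i + 1) :
    ∃ v, IsCycleSeq (2 * s) K F v := by
  induction hm : (completeBipartiteGraph (Fin s) (Fin s) \ K).edgeSet.ncard
    using Nat.strong_induction_on generalizing K with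
  | _ m ih
  subst hm
  rcases eq_or_ne (completeBipartiteGraph (Fin s) (Fin s) \ K) ⊥ with hbot | hne
  · obtain rfl : K = completeBipartiteGraph (Fin s) (Fin s) :=
      le_antisymm hK (sdiff_eq_bot_iff.1 hbot)
    exact exists_isCycleSeq_completeBipartiteGraph hs F hFK hdeg hac
  obtain ⟨x, y, hxy⟩ := ne_bot_iff_exists_adj.1 hne
  have hxy' := hxy
  rw [sdiff_adj] at hxy'
  have hlt : (completeBipartiteGraph (Fin s) (Fin s) \ (K ⊔ edge x y)).edgeSet.ncard <
      (completeBipartiteGraph (Fin s) (Fin s) \ K).edgeSet.ncard := by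
    refine Set.ncard_lt_ncard (edgeSet_ssubset_edgeSet.2 (lt_of_le_of_ne ?_ ?_))
    · exact sdiff_le_sdiff_left le_sup_left
    · intro e
      rw [← e, sdiff_adj] at hxy
      exact hxy.2 (.inr (by simp [edge_adj, hxy'.1.ne]))
  obtain ⟨v, hv⟩ := ih _ hlt (K := K ⊔ edge x y)
    (sup_le hK ((edge_le_iff _).2 (.inr hxy'.1))) (hFK.trans le_sup_left) (by lia) rfl
  exact exists_isCycleSeq_of_sup_edge hi hK hFK hmiss hFe hmatch hxy'.2 hv

theorem ncard_edgeSet_completeBipartiteGraph :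
    (completeBipartiteGraph (Fin s) (Fin s)).edgeSet.ncard = s ^ 2 := by
  have : (completeBipartiteGraph (Fin s) (Fin s)).edgeSet =
      Set.range fun p : Fin s × Fin s => s(Sum.inl p.1, Sum.inr p.2) := by
    ext e
    induction e with | _ x y
    rcases x with x | x <;> rcases y with y | y <;> simp
  rw [this, Set.ncard_range_of_injective, Nat.card_prod, Nat.card_fin, sq]
  rintro ⟨a, b⟩ ⟨c, d⟩ e
  simpa using e

/-- A graph with at most four edges and at most two nontrivial components has no matching with
four edges. -/
theorem card_matching_le_three {V : Type*} [Finite V] {n : ℕ} {F : SimpleGraph V}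
    (hFe : F.edgeSet.ncard ≤ 4)
    (hcomp : ∃ v₁ v₂, ∀ w, (∃ u, F.Adj w u) → F.Reachable w v₁ ∨ F.Reachable w v₂)
    {w : ℕ → V} (inj : ∀ t u, t < 2 * n → u < 2 * n → w t = w u → t = u) (O : Finset ℕ)
    (hO : ∀ j ∈ O, j < n ∧ F.Adj (w (2 * j)) (w (2 * j + 1))) : O.card ≤ 3 := by
  classical
  by_contra! hcard
  have := Fintype.ofFinite V
  rw [Set.ncard_eq_toFinset_card'] at hFe
  have hsub : O.image (fun j => s(w (2 * j), w (2 * j + 1))) ⊆ F.edgeSet.toFinset := by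
    intro e he
    obtain ⟨j, hj, rfl⟩ := Finset.mem_image.1 he
    simpa using (hO j hj).2
  have hedges : O.image (fun j => s(w (2 * j), w (2 * j + 1))) = F.edgeSet.toFinset := by
    refine Finset.eq_of_subset_of_card_le hsub ?_
    rw [Finset.card_image_of_injOn]
    · lia
    · intro j hj k hk e
      have h1 := (hO j hj).1
      have h2 := (hO k hk).1
      rcases Sym2.eq_iff.1 e with ⟨e, -⟩ | ⟨e, -⟩ <;>
        have := inj _ _ (by lia) (by lia) e <;> lia
  have hadj {x y : V} (h : F.Adj x y) : ∃ j ∈ O, s(w (2 * j), w (2 * j + 1)) = s(x, y) := by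
    have : s(x, y) ∈ F.edgeSet.toFinset := by simpa using h
    rwa [← hedges, Finset.mem_image] at this
  have hreach {j : ℕ} (hj : j ∈ O) {y : V} (h : F.Reachable (w (2 * j)) y) :
      y = w (2 * j) ∨ y = w (2 * j + 1) := by
    rw [reachable_iff_reflTransGen] at h
    induction h with
    | refl => exact .inl rfl
    | tail _ hbc ih =>
      obtain ⟨k, hk, e⟩ := hadj hbc
      have h1 := (hO j hj).1
      have h2 := (hO k hk).1
      rcases ih with rfl | rfl <;> rcases Sym2.eq_iff.1 e with ⟨e1, e2⟩ | ⟨e1, e2⟩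
      · obtain rfl : k = j := by have := inj _ _ (by lia) (by lia) e1; lia
        exact .inr e2.symm
      · have := inj _ _ (by lia) (by lia) e2; lia
      · have := inj _ _ (by lia) (by lia) e1; lia
      · obtain rfl : k = j := by have := inj _ _ (by lia) (by lia) e2; lia
        exact .inl e1.symm
  have hsame {j k : ℕ} (hj : j ∈ O) (hk : k ∈ O) (h : F.Reachable (w (2 * j)) (w (2 * k))) :
      j = k := by
    have h1 := (hO j hj).1
    have h2 := (hO k hk).1
    rcases hreach hj h with e | e <;> have := inj _ _ (by lia) (by lia) e <;> lia
  obtain ⟨v₁, v₂, hv⟩ := hcomp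
  have hone (v : V) : (O.filter fun j => F.Reachable (w (2 * j)) v).card ≤ 1 := by
    rw [Finset.card_le_one]
    intro j hj k hk
    rw [Finset.mem_filter] at hj hk
    exact hsame hj.1 hk.1 (hj.2.trans hk.2.symm)
  have hcover : O ⊆ (O.filter fun j => F.Reachable (w (2 * j)) v₁) ∪
      (O.filter fun j => F.Reachable (w (2 * j)) v₂) := by
    intro j hj
    simpa [hj] using hv _ ⟨_, (hO j hj).2⟩
  have h1 := Finset.card_le_card hcover
  have h2 := Finset.card_union_le (O.filter fun j => F.Reachable (w (2 * j)) v₁)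
    (O.filter fun j => F.Reachable (w (2 * j)) v₂)
  have h3 := hone v₁
  have h4 := hone v₂
  lia

theorem card_matching_le_ncard_edgeSet {V : Type*} [Finite V] {n : ℕ} {F : SimpleGraph V}
    {w : ℕ → V} (inj : ∀ t u, t < 2 * n → u < 2 * n → w t = w u → t = u) (O : Finset ℕ)
    (hO : ∀ j ∈ O, j < n ∧ F.Adj (w (2 * j)) (w (2 * j + 1))) : O.card ≤ F.edgeSet.ncard := by
  rw [← Set.ncard_coe_finset]
  refine Set.ncard_le_ncard_of_injOn (fun j => s(w (2 * j), w (2 * j + 1)))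
    (fun j hj => (hO j hj).2) ?_
  intro j hj k hk e
  have h1 := (hO j hj).1
  have h2 := (hO k hk).1
  rcases Sym2.eq_iff.1 e with ⟨e, -⟩ | ⟨e, -⟩ <;>
    have := inj _ _ (by lia) (by lia) e <;> lia

end Bipartite

/-- Zamani–West (corollary): let `s ≥ 4`, `i ∈ {1,2}`, and let `K` be a subgraph
of `K_{s,s}` with at least `s² - s + 2 + i` edges.  Then for every linear forest
`F ⊆ K` with at most `2i` edges and at most two (nontrivial) components, `K` has
a hamiltonian cycle containing all edges of `F`. -/
theorem stmt_16 (s i : ℕ) (hs : 4 ≤ s) (hi : i = 1 ∨ i = 2)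
    (K : SimpleGraph (Fin s ⊕ Fin s))
    (hK : K ≤ completeBipartiteGraph (Fin s) (Fin s))
    (he : s ^ 2 - s + 2 + i ≤ K.edgeSet.ncard)
    (F : SimpleGraph (Fin s ⊕ Fin s)) (hFK : F ≤ K) (hF : IsLinearForest F)
    (hFe : F.edgeSet.ncard ≤ 2 * i)
    (hcomp : ∃ v₁ v₂ : Fin s ⊕ Fin s, ∀ w, (∃ u, F.Adj w u) →
      F.Reachable w v₁ ∨ F.Reachable w v₂) :
    ∃ (v : Fin s ⊕ Fin s) (c : K.Walk v v), c.IsHamiltonianCycle ∧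
      ∀ e ∈ F.edgeSet, e ∈ c.edges := by
  have hcard : Fintype.card (Fin s ⊕ Fin s) = 2 * s := by simp; lia
  have hmiss : (completeBipartiteGraph (Fin s) (Fin s) \ K).edgeSet.ncard + i + 2 ≤ s := by
    have h1 : (completeBipartiteGraph (Fin s) (Fin s) \ K).edgeSet.ncard + K.edgeSet.ncard =
        s ^ 2 := by
      rw [edgeSet_sdiff, Set.ncard_sdiff_add_ncard_of_subset (edgeSet_subset_edgeSet.2 hK),
        ncard_edgeSet_completeBipartiteGraph]
    have h2 : s ≤ s ^ 2 := Nat.le_self_pow (by lia) s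
    lia
  obtain ⟨v, hv⟩ := exists_isCycleSeq (by lia) (by lia) hK hFK hmiss hF.1
    (fun v w => hF.2 v w) hFe fun w inj O hO => by
      rcases hi with rfl | rfl
      · exact (card_matching_le_ncard_edgeSet inj O hO).trans hFe
      · exact card_matching_le_three hFe hcomp inj O hO
  exact hv.exists_isHamiltonianCycle hcard (by lia)
end
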